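/- arXiv:2512.05957 — 7 statements merged into one kernel-verified Lean document; each statement's English description precedes it below -/
import Mathlib

section
/- Let a > 1/2 and l > 0. For every ω ∈ ℝ, the one-dimensional Fourier transform of the rational-quadratic kernel satisfies ∫_ℝ (1 + r²/(2al²))^{-a} · exp(-iωr) dr = ((2al²)^a · √π / Γ(a)) · ∫₀^∞ τ^{a-3/2} · exp(-2al²τ - ω²/(4τ)) dτ. -/
open MeasureTheory

theorem rq_aux_prod {τ c : ℝ} (a : ℝ) (hτ : 0 < τ) :
    τ ^ (a - 1) * Real.exp (-(c * τ)) * Real.sqrt (Real.pi / τ) =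
      Real.sqrt Real.pi * (τ ^ (a - 3 / 2) * Real.exp (-(c * τ))) := by
  have h : τ ^ (a - 3 / 2) = τ ^ (a - 1) / Real.sqrt τ := by
    rw [Real.sqrt_eq_rpow, ← Real.rpow_sub hτ]
    congr 1
    ring
  rw [h, Real.sqrt_div Real.pi_pos.le]
  ring

theorem rq_aux_norm (a c ω r : ℝ) {τ : ℝ} (hτ : 0 < τ) :
    ‖((τ ^ (a - 1) * Real.exp (-((c + r ^ 2) * τ)) : ℝ) : ℂ) *
      Complex.exp (-Complex.I * ((ω * r : ℝ) : ℂ))‖ =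
      τ ^ (a - 1) * Real.exp (-(c * τ)) * Real.exp (-τ * r ^ 2) := by
  have h1 : ‖Complex.exp (-Complex.I * ((ω * r : ℝ) : ℂ))‖ = 1 := by
    rw [Complex.norm_exp]
    simp
  rw [norm_mul, h1, mul_one, Complex.norm_real, Real.norm_of_nonneg (by positivity), mul_assoc,
    ← Real.exp_add]
  congr 2
  ring

theorem rq_aux_integrable (a c ω : ℝ) (ha : 1 / 2 < a) (hc : 0 < c) :
    Integrable (Function.uncurry fun (r τ : ℝ) =>
      ((τ ^ (a - 1) * Real.exp (-((c + r ^ 2) * τ)) : ℝ) : ℂ) *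
        Complex.exp (-Complex.I * ((ω * r : ℝ) : ℂ)))
      (volume.prod (volume.restrict (Set.Ioi (0 : ℝ)))) := by
  have hm : Measurable (Function.uncurry fun (r τ : ℝ) =>
      ((τ ^ (a - 1) * Real.exp (-((c + r ^ 2) * τ)) : ℝ) : ℂ) *
        Complex.exp (-Complex.I * ((ω * r : ℝ) : ℂ))) := by
    unfold Function.uncurry
    fun_prop
  rw [integrable_prod_iff' hm.aestronglyMeasurable]
  constructor
  · filter_upwards [ae_restrict_mem measurableSet_Ioi] with τ hτ
    have hg : Integrable fun r : ℝ =>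
        τ ^ (a - 1) * Real.exp (-(c * τ)) * Real.exp (-τ * r ^ 2) :=
      (integrable_exp_neg_mul_sq hτ).const_mul _
    refine hg.mono' (hm.comp (by fun_prop : Measurable fun r : ℝ => (r, τ))).aestronglyMeasurable ?_
    exact Filter.Eventually.of_forall fun r => (rq_aux_norm a c ω r hτ).le
  · have h0 : IntegrableOn (fun τ : ℝ => Real.sqrt Real.pi *
        (τ ^ (a - 3 / 2) * Real.exp (-(c * τ)))) (Set.Ioi 0) := by
      have := integrableOn_rpow_mul_exp_neg_mul_rpow (p := 1) (s := a - 3 / 2) (b := c)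
        (by linarith) one_pos hc
      simp only [Real.rpow_one, neg_mul] at this
      exact Integrable.const_mul this _
    refine Integrable.congr h0 ?_
    filter_upwards [ae_restrict_mem measurableSet_Ioi] with τ hτ
    have hτ' : 0 < τ := hτ
    simp only [Function.uncurry]
    simp_rw [rq_aux_norm a c ω _ hτ']
    rw [integral_const_mul, integral_gaussian, rq_aux_prod a hτ']

theorem rq_aux_inner (a c ω : ℝ) {τ : ℝ} (hτ : 0 < τ) :
    ∫ r : ℝ, ((τ ^ (a - 1) * Real.exp (-((c + r ^ 2) * τ)) : ℝ) : ℂ) *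
        Complex.exp (-Complex.I * ((ω * r : ℝ) : ℂ)) =
      ((Real.sqrt Real.pi * (τ ^ (a - 3 / 2) * Real.exp (-(c * τ) - ω ^ 2 / (4 * τ))) : ℝ) : ℂ) := by
  have hF := fourierIntegral_gaussian (b := (τ : ℂ)) (by simpa using hτ) (-ω : ℂ)
  have hs : ((Real.pi : ℂ) / τ) ^ (1 / 2 : ℂ) = ((Real.sqrt (Real.pi / τ) : ℝ) : ℂ) := by
    rw [Real.sqrt_eq_rpow, Complex.ofReal_cpow (by positivity)]
    push_cast
    rfl
  have he : Complex.exp (-(-ω : ℂ) ^ 2 / (4 * τ)) = ((Real.exp (-(ω ^ 2 / (4 * τ))) : ℝ) : ℂ) := by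
    push_cast
    congr 1
    ring
  rw [hs, he] at hF
  have hfun : (fun r : ℝ => ((τ ^ (a - 1) * Real.exp (-((c + r ^ 2) * τ)) : ℝ) : ℂ) *
        Complex.exp (-Complex.I * ((ω * r : ℝ) : ℂ))) = fun r : ℝ =>
      ((τ ^ (a - 1) * Real.exp (-(c * τ)) : ℝ) : ℂ) *
        (Complex.exp (Complex.I * (-ω : ℂ) * r) * Complex.exp (-(τ : ℂ) * r ^ 2)) := by
    funext r
    push_cast
    rw [mul_assoc, mul_assoc, ← Complex.exp_add, ← Complex.exp_add, ← Complex.exp_add]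
    congr 2
    ring
  rw [hfun, integral_const_mul, hF, ← Complex.ofReal_mul, ← Complex.ofReal_mul, ← mul_assoc,
    rq_aux_prod a hτ, sub_eq_add_neg (-(c * τ)), Real.exp_add]
  congr 1
  ring

theorem rq_aux_outer (a c ω r : ℝ) (ha : 0 < a) (hc : 0 < c) :
    (((1 + r ^ 2 / c) ^ (-a) : ℝ) : ℂ) * Complex.exp (-Complex.I * ((ω * r : ℝ) : ℂ)) =
      ((c ^ a / Real.Gamma a : ℝ) : ℂ) * ∫ τ in Set.Ioi (0 : ℝ),
        ((τ ^ (a - 1) * Real.exp (-((c + r ^ 2) * τ)) : ℝ) : ℂ) *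
        Complex.exp (-Complex.I * ((ω * r : ℝ) : ℂ)) := by
  have hp : 0 < c + r ^ 2 := by positivity
  rw [integral_mul_const, integral_complex_ofReal, Real.integral_rpow_mul_exp_neg_mul_Ioi ha hp,
    ← mul_assoc, ← Complex.ofReal_mul]
  congr 2
  have hG := (Real.Gamma_pos_of_pos ha).ne'
  have h1 : 1 + r ^ 2 / c = (c + r ^ 2) / c := by field_simp
  rw [h1, Real.rpow_neg (by positivity), Real.div_rpow hp.le hc.le,
    Real.div_rpow zero_le_one hp.le, Real.one_rpow]
  field_simp

/-- The one-dimensional Fourier transform of the rational-quadratic kernel is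
`((2al²)^a √π / Γ(a)) ∫₀^∞ τ^{a-3/2} exp(-2al²τ - ω²/(4τ)) dτ`. -/
theorem rationalQuadratic_fourier_one_dim (a l : ℝ) (ha : 1 / 2 < a) (hl : 0 < l) (ω : ℝ) :
    ∫ r : ℝ,
        (((1 + r ^ 2 / (2 * a * l ^ 2)) ^ (-a) : ℝ) : ℂ) *
          Complex.exp (-Complex.I * ((ω * r : ℝ) : ℂ)) =
      ((((2 * a * l ^ 2) ^ a * Real.sqrt Real.pi / Real.Gamma a) *
        ∫ τ in Set.Ioi (0 : ℝ),
          τ ^ (a - 3 / 2) * Real.exp (-(2 * a * l ^ 2 * τ) - ω ^ 2 / (4 * τ)) : ℝ) : ℂ) := by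
  have ha0 : 0 < a := by linarith
  have hc : 0 < 2 * a * l ^ 2 := by positivity
  generalize 2 * a * l ^ 2 = c at hc ⊢
  simp_rw [rq_aux_outer a c ω _ ha0 hc]
  rw [integral_const_mul, integral_integral_swap (rq_aux_integrable a c ω ha hc),
    setIntegral_congr_fun measurableSet_Ioi (fun τ hτ => rq_aux_inner a c ω hτ),
    integral_complex_ofReal, integral_const_mul, ← Complex.ofReal_mul]
  congr 1
  ring
end

section
/- Let d ≥ 1, a > d/2 and l > 0, and define F(ω) = ∫_{ℝ^d} (1 + ‖x‖²/(2al²))^{-a} · exp(-i⟨ω,x⟩) dx for ω ∈ ℝ^d. Then there exist finite constants C₁, C₂ > 0 such that |F(ω)| ≤ C₁ · exp(-C₂‖ω‖) for all ω ∈ ℝ^d; that is, the Fourier transform of the rational-quadratic kernel decays exponentially. -/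
open MeasureTheory
open scoped RealInnerProductSpace

/-- The integrand of the Gaussian-mixture representation of the kernel. -/
noncomputable def rqG (d : ℕ) (a c : ℝ) (ω x : EuclideanSpace ℝ (Fin d)) (s : ℝ) : ℂ :=
  ((s ^ (a - 1) * Real.exp (-s) : ℝ) : ℂ) *
    Complex.exp (-((s * c : ℝ) : ℂ) * (‖x‖ : ℂ) ^ 2 + (-Complex.I) * ((⟪ω, x⟫ : ℝ) : ℂ))

lemma rqG_norm (d : ℕ) (a c : ℝ) (ω x : EuclideanSpace ℝ (Fin d)) (s : ℝ) (hs : 0 < s) :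
    ‖rqG d a c ω x s‖ = (s ^ (a - 1) * Real.exp (-s)) * Real.exp (-(s * c) * ‖x‖ ^ 2) := by
  unfold rqG
  rw [norm_mul, Complex.norm_real, Real.norm_of_nonneg (by positivity), Complex.norm_exp]
  congr 2
  have : (-((s * c : ℝ) : ℂ) * (‖x‖ : ℂ) ^ 2) = ((-(s * c) * ‖x‖ ^ 2 : ℝ) : ℂ) := by
    push_cast; ring
  rw [this, Complex.add_re, Complex.ofReal_re]
  simp

lemma rqG_measurable (d : ℕ) (a c : ℝ) (ω : EuclideanSpace ℝ (Fin d)) :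
    Measurable (Function.uncurry (rqG d a c ω)) := by
  unfold rqG Function.uncurry
  fun_prop

lemma rq_weight (d : ℕ) (a c s : ℝ) (hc : 0 < c) (hs : 0 < s) :
    s ^ (a - 1) * (Real.pi / (s * c)) ^ ((d : ℝ) / 2) =
      (Real.pi / c) ^ ((d : ℝ) / 2) * s ^ ((a - d / 2) - 1) := by
  rw [show Real.pi / (s * c) = (Real.pi / c) * s⁻¹ by field_simp,
    Real.mul_rpow (by positivity) (by positivity), Real.inv_rpow hs.le,
    ← Real.rpow_neg hs.le, show (a - d / 2) - 1 = (a - 1) + (-((d : ℝ) / 2)) by ring,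
    Real.rpow_add hs]
  ring

lemma rq_gamma_int (b r : ℝ) (hb : 0 < b) (hr : 0 < r) :
    IntegrableOn (fun t : ℝ => t ^ (b - 1) * Real.exp (-(r * t))) (Set.Ioi 0) := by
  have hG := Real.Gamma_pos_of_pos hb
  apply Integrable.of_integral_ne_zero
  rw [Real.integral_rpow_mul_exp_neg_mul_Ioi hb hr]
  positivity

lemma rqG_integrable (d : ℕ) (a c : ℝ) (ω : EuclideanSpace ℝ (Fin d))
    (ha : (d : ℝ) / 2 < a) (hc : 0 < c) :
    Integrable (Function.uncurry (rqG d a c ω))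
      ((volume : Measure (EuclideanSpace ℝ (Fin d))).prod
        ((volume : Measure ℝ).restrict (Set.Ioi 0))) := by
  rw [integrable_prod_iff' (rqG_measurable d a c ω).aestronglyMeasurable]
  constructor
  · refine (ae_restrict_iff' measurableSet_Ioi).2 (ae_of_all _ fun s (hs : 0 < s) => ?_)
    simp only [Function.uncurry, rqG]
    refine Integrable.const_mul ?_ _
    exact GaussianFourier.integrable_cexp_neg_mul_sq_norm_add
      (by rw [Complex.ofReal_re]; positivity) _ _
  · have h := (rq_gamma_int (a - d / 2) 1 (by linarith) one_pos).const_mul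
      ((Real.pi / c) ^ ((d : ℝ) / 2))
    refine IntegrableOn.congr_fun h (fun s (hs : 0 < s) => ?_) measurableSet_Ioi
    simp only [Function.uncurry, rqG_norm d a c ω _ s hs]
    rw [integral_const_mul, GaussianFourier.integral_rexp_neg_mul_sq_norm (by positivity),
      finrank_euclideanSpace_fin, ← mul_assoc, ← rq_weight d a c s hc hs]
    simp only [one_mul]
    ring

lemma rqG_integral_s (d : ℕ) (a c : ℝ) (ω x : EuclideanSpace ℝ (Fin d))
    (ha : 0 < a) (hc : 0 < c) :
    ∫ s in Set.Ioi 0, rqG d a c ω x s =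
      (Real.Gamma a : ℂ) * ((((1 + ‖x‖ ^ 2 * c) ^ (-a) : ℝ) : ℂ) *
        Complex.exp (-Complex.I * ((⟪ω, x⟫ : ℝ) : ℂ))) := by
  have hr : 0 < 1 + ‖x‖ ^ 2 * c := by positivity
  have h := Real.integral_rpow_mul_exp_neg_mul_Ioi ha hr
  have e : ∀ s : ℝ, rqG d a c ω x s =
      ((s ^ (a - 1) * Real.exp (-((1 + ‖x‖ ^ 2 * c) * s)) : ℝ) : ℂ) *
        Complex.exp (-Complex.I * ((⟪ω, x⟫ : ℝ) : ℂ)) := by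
    intro s
    unfold rqG
    rw [Complex.exp_add, ← mul_assoc]
    congr 1
    push_cast
    rw [mul_assoc, ← Complex.exp_add]
    congr 2
    ring
  simp_rw [e]
  rw [integral_mul_const, integral_complex_ofReal, h, one_div, Real.inv_rpow hr.le,
    ← Real.rpow_neg hr.le]
  push_cast
  ring

lemma rqG_integral_x (d : ℕ) (a c : ℝ) (ω : EuclideanSpace ℝ (Fin d)) (s : ℝ)
    (hc : 0 < c) (hs : 0 < s) :
    ‖∫ x, rqG d a c ω x s‖ ≤ Real.exp (-(1 / Real.sqrt (2 * c)) * ‖ω‖) *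
      ((Real.pi / c) ^ ((d : ℝ) / 2) * (s ^ ((a - d / 2) - 1) * Real.exp (-(1 / 2 * s)))) := by
  unfold rqG
  rw [integral_const_mul, GaussianFourier.integral_cexp_neg_mul_sq_norm_add
      (by rw [Complex.ofReal_re]; positivity), finrank_euclideanSpace_fin, norm_mul, norm_mul,
    Complex.norm_real, Real.norm_of_nonneg (by positivity)]
  have h1 : ((Real.pi : ℂ) / ((s * c : ℝ) : ℂ)) ^ ((d : ℂ) / 2) =
      (((Real.pi / (s * c)) ^ ((d : ℝ) / 2) : ℝ) : ℂ) := by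
    rw [Complex.ofReal_cpow (by positivity)]
    push_cast
    rfl
  have h2 : (-Complex.I) ^ 2 * (‖ω‖ : ℂ) ^ 2 / (4 * ((s * c : ℝ) : ℂ)) =
      ((-(‖ω‖ ^ 2 / (4 * (s * c))) : ℝ) : ℂ) := by
    rw [neg_sq, Complex.I_sq]
    push_cast
    ring
  rw [h1, h2, Complex.norm_real, Real.norm_of_nonneg (by positivity), Complex.norm_exp,
    Complex.ofReal_re]
  have h3 : Real.exp (-s) * Real.exp (-(‖ω‖ ^ 2 / (4 * (s * c)))) ≤
      Real.exp (-(1 / Real.sqrt (2 * c)) * ‖ω‖) * Real.exp (-(1 / 2 * s)) := by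
    rw [← Real.exp_add, ← Real.exp_add]
    apply Real.exp_le_exp.2
    have hq : 0 < Real.sqrt (2 * c) := by positivity
    have hq2 : Real.sqrt (2 * c) ^ 2 = 2 * c := Real.sq_sqrt (by positivity)
    set q := Real.sqrt (2 * c)
    have hcq : c = q ^ 2 / 2 := by linarith
    rw [hcq]
    have : -(1 / q) * ‖ω‖ + -(1 / 2 * s) - (-s + -(‖ω‖ ^ 2 / (4 * (s * (q ^ 2 / 2))))) =
        (s * q - ‖ω‖) ^ 2 / (2 * s * q ^ 2) := by
      field_simp
      ring
    have h0 : 0 ≤ (s * q - ‖ω‖) ^ 2 / (2 * s * q ^ 2) := by positivity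
    linarith
  have hw := rq_weight d a c s hc hs
  calc _ = (s ^ (a - 1) * (Real.pi / (s * c)) ^ ((d : ℝ) / 2)) *
        (Real.exp (-s) * Real.exp (-(‖ω‖ ^ 2 / (4 * (s * c))))) := by ring
    _ ≤ (s ^ (a - 1) * (Real.pi / (s * c)) ^ ((d : ℝ) / 2)) *
        (Real.exp (-(1 / Real.sqrt (2 * c)) * ‖ω‖) * Real.exp (-(1 / 2 * s))) := by
      gcongr
    _ = _ := by rw [hw]; ring

/-- The Fourier transform of the rational-quadratic kernel on `ℝ^d` decays exponentially:
there are constants `C₁, C₂ > 0` with `|F(ω)| ≤ C₁ exp(-C₂‖ω‖)`. -/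
theorem rationalQuadratic_fourier_exponential_decay (d : ℕ) (hd : 1 ≤ d)
    (a l : ℝ) (ha : (d : ℝ) / 2 < a) (hl : 0 < l) :
    ∃ C₁ C₂ : ℝ, 0 < C₁ ∧ 0 < C₂ ∧
      ∀ ω : EuclideanSpace ℝ (Fin d),
        ‖∫ x : EuclideanSpace ℝ (Fin d),
            (((1 + ‖x‖ ^ 2 / (2 * a * l ^ 2)) ^ (-a) : ℝ) : ℂ) *
              Complex.exp (-Complex.I * ((⟪ω, x⟫ : ℝ) : ℂ))‖ ≤
          C₁ * Real.exp (-C₂ * ‖ω‖) := by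
  have ha0 : 0 < a := lt_of_le_of_lt (by positivity) ha
  have hc : 0 < 1 / (2 * a * l ^ 2) := by positivity
  obtain ⟨c, hcdef⟩ : ∃ c, c = 1 / (2 * a * l ^ 2) := ⟨_, rfl⟩
  rw [← hcdef] at hc
  have hb : 0 < a - (d : ℝ) / 2 := by linarith
  have hG := Real.Gamma_pos_of_pos ha0
  have hGb := Real.Gamma_pos_of_pos hb
  have hJ := Real.integral_rpow_mul_exp_neg_mul_Ioi hb (one_half_pos (α := ℝ))
  refine ⟨(Real.Gamma a)⁻¹ * ((Real.pi / c) ^ ((d : ℝ) / 2) *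
    ((1 / (1 / 2)) ^ (a - (d : ℝ) / 2) * Real.Gamma (a - (d : ℝ) / 2))),
    1 / Real.sqrt (2 * c), by positivity, by positivity, fun ω => ?_⟩
  have hswap := integral_integral_swap (rqG_integrable d a c ω ha hc)
  simp_rw [rqG_integral_s d a c ω _ ha0 hc] at hswap
  rw [integral_const_mul] at hswap
  have hbound : ‖∫ s in Set.Ioi 0, ∫ x, rqG d a c ω x s‖ ≤
      Real.exp (-(1 / Real.sqrt (2 * c)) * ‖ω‖) * ((Real.pi / c) ^ ((d : ℝ) / 2) *
        ((1 / (1 / 2)) ^ (a - (d : ℝ) / 2) * Real.Gamma (a - (d : ℝ) / 2))) := by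
    rw [← hJ, ← integral_const_mul, ← integral_const_mul]
    refine norm_integral_le_of_norm_le
      (((rq_gamma_int _ _ hb one_half_pos).const_mul _).const_mul _) ?_
    exact (ae_restrict_iff' measurableSet_Ioi).2
      (ae_of_all _ fun s (hs : 0 < s) => rqG_integral_x d a c ω s hc hs)
  rw [← hswap, norm_mul, Complex.norm_real, Real.norm_of_nonneg hG.le] at hbound
  have hdiv : ∀ y : ℝ, y / (2 * a * l ^ 2) = y * c := by
    intro y
    rw [hcdef]
    ring
  simp_rw [hdiv]
  rw [mul_assoc, inv_mul_eq_div, le_div_iff₀' hG]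
  linarith
end

section
/- Let d ≥ 1 and 0 < γ < 2, and define F(ω) = ∫_{ℝ^d} exp(-‖x‖^γ) · exp(-i⟨ω,x⟩) dx for ω ∈ ℝ^d. Then F(ω) is real-valued (its imaginary part vanishes for every ω), and there exist finite constants C₁, C₂ > 0 such that for all ω ∈ ℝ^d, C₁ · (1 + ‖ω‖)^{-(γ+d)} ≤ Re F(ω) ≤ C₂ · (1 + ‖ω‖)^{-(γ+d)}; that is, the Fourier transform of the γ-exponential kernel decays polynomially with rate exactly γ + d. -/
open MeasureTheory
open scoped RealInnerProductSpace

/-- Cosine transform. -/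
noncomputable def cosT {d : ℕ} (f : EuclideanSpace ℝ (Fin d) → ℝ) (ω : EuclideanSpace ℝ (Fin d)) : ℝ :=
  ∫ x, f x * Real.cos ⟪ω, x⟫

/-- nonnegative and antitone in the norm. -/
def NNA {d : ℕ} (G : EuclideanSpace ℝ (Fin d) → ℝ) : Prop :=
  (∀ ω, 0 ≤ G ω) ∧ ∀ ω ω', ‖ω‖ ≤ ‖ω'‖ → G ω' ≤ G ω

/-- Gaussian-regularised transforms are nonnegative and radially antitone. -/
def Good {d : ℕ} (h : EuclideanSpace ℝ (Fin d) → ℝ) : Prop :=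
  Continuous h ∧ (∃ C, ∀ x, |h x| ≤ C) ∧
    ∀ t : ℝ, 0 < t → NNA (cosT (fun x => h x * Real.exp (-t * ‖x‖ ^ 2)))

lemma gauss_integrable {d : ℕ} {t : ℝ} (ht : 0 < t) :
    Integrable (fun x : EuclideanSpace ℝ (Fin d) => Real.exp (-t * ‖x‖ ^ 2)) := by
  have := (GaussianFourier.integrable_cexp_neg_mul_sq_norm_add (b := (t : ℂ)) (by simpa using ht) 0
    (0 : EuclideanSpace ℝ (Fin d))).re
  refine this.congr (Filter.Eventually.of_forall fun x => ?_)
  have h : (-(t : ℂ) * (‖x‖ : ℂ) ^ 2 + 0 * ((⟪(0 : EuclideanSpace ℝ (Fin d)), x⟫ : ℝ) : ℂ))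
    = ((-t * ‖x‖ ^ 2 : ℝ) : ℂ) := by push_cast; ring
  simp only [h, ← Complex.ofReal_exp]
  exact Complex.ofReal_re _

lemma gauss_cosT {d : ℕ} {t : ℝ} (ht : 0 < t) (ω : EuclideanSpace ℝ (Fin d)) :
    ∫ x, Real.exp (-t * ‖x‖ ^ 2) * Real.cos ⟪ω, x⟫
      = (Real.pi / t) ^ ((d : ℝ) / 2) * Real.exp (-‖ω‖ ^ 2 / (4 * t)) := by
  have hI := GaussianFourier.integrable_cexp_neg_mul_sq_norm_add (b := (t : ℂ)) (by simpa using ht)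
    Complex.I ω
  have h := GaussianFourier.integral_cexp_neg_mul_sq_norm_add (b := (t : ℂ)) (by simpa using ht)
    Complex.I ω
  have h2 := congrArg Complex.re h
  have h3 := integral_re hI
  simp only [RCLike.re_to_complex] at h3
  rw [← h3] at h2
  have e1 : ∀ x : EuclideanSpace ℝ (Fin d), (Complex.exp (-(t : ℂ) * (‖x‖ : ℂ) ^ 2 +
      Complex.I * ((⟪ω, x⟫ : ℝ) : ℂ))).re = Real.exp (-t * ‖x‖ ^ 2) * Real.cos ⟪ω, x⟫ := by
    intro x
    rw [Complex.exp_re]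
    congr 2
    · simp [← Complex.ofReal_pow]
    · simp [← Complex.ofReal_pow]
  simp_rw [e1] at h2
  rw [h2]
  have e2 : ((Real.pi : ℂ) / t) ^ (((Module.finrank ℝ (EuclideanSpace ℝ (Fin d)) : ℕ) : ℂ) / 2)
      = (((Real.pi / t) ^ ((d : ℝ) / 2) : ℝ) : ℂ) := by
    rw [Complex.ofReal_cpow (by positivity)]
    simp
  have e3 : Complex.I ^ 2 * (‖ω‖ : ℂ) ^ 2 / (4 * (t : ℂ)) = ((-‖ω‖ ^ 2 / (4 * t) : ℝ) : ℂ) := by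
    push_cast; simp
  rw [e2, e3, ← Complex.ofReal_exp, ← Complex.ofReal_mul, Complex.ofReal_re]

lemma NNA_gauss {d : ℕ} {t : ℝ} (ht : 0 < t) :
    NNA (cosT (fun x : EuclideanSpace ℝ (Fin d) => Real.exp (-t * ‖x‖ ^ 2))) := by
  unfold NNA cosT
  simp_rw [gauss_cosT ht]
  refine ⟨fun ω => by positivity, fun ω ω' h => ?_⟩
  gcongr

lemma good_one {d : ℕ} : Good (fun _ : EuclideanSpace ℝ (Fin d) => (1 : ℝ)) :=
  ⟨continuous_const, ⟨1, by simp⟩, fun t ht => by simpa using NNA_gauss ht⟩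

lemma Good.integrable {d : ℕ} {h : EuclideanSpace ℝ (Fin d) → ℝ} (hc : Continuous h)
    {C : ℝ} (hb : ∀ x, |h x| ≤ C) {t : ℝ} (ht : 0 < t) (ω : EuclideanSpace ℝ (Fin d)) :
    Integrable (fun x => h x * Real.exp (-t * ‖x‖ ^ 2) * Real.cos ⟪ω, x⟫) := by
  refine ((gauss_integrable ht).const_mul C).mono' (by fun_prop) (Filter.Eventually.of_forall fun x => ?_)
  rw [norm_mul, norm_mul, Real.norm_eq_abs, Real.norm_eq_abs, Real.norm_eq_abs, Real.abs_exp]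
  have := Real.abs_cos_le_one ⟪ω, x⟫
  have h1 := hb x
  calc _ ≤ |h x| * Real.exp (-t * ‖x‖ ^ 2) * 1 := by gcongr
    _ ≤ _ := by rw [mul_one]; gcongr

lemma NNA.add {d : ℕ} {f g : EuclideanSpace ℝ (Fin d) → ℝ} (hf : NNA f) (hg : NNA g) :
    NNA (fun x => f x + g x) :=
  ⟨fun ω => add_nonneg (hf.1 ω) (hg.1 ω), fun _ _ h => add_le_add (hf.2 _ _ h) (hg.2 _ _ h)⟩

lemma NNA.const_mul {d : ℕ} {f : EuclideanSpace ℝ (Fin d) → ℝ} (hf : NNA f) {c : ℝ} (hc : 0 ≤ c) :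
    NNA (fun x => c * f x) :=
  ⟨fun ω => mul_nonneg hc (hf.1 ω), fun _ _ h => mul_le_mul_of_nonneg_left (hf.2 _ _ h) hc⟩

lemma NNA.lim {d : ℕ} {f : ℕ → EuclideanSpace ℝ (Fin d) → ℝ} (hf : ∀ n, NNA (f n))
    {g : EuclideanSpace ℝ (Fin d) → ℝ}
    (h : ∀ x, Filter.Tendsto (fun n => f n x) Filter.atTop (nhds (g x))) : NNA g :=
  ⟨fun ω => ge_of_tendsto' (h ω) fun n => (hf n).1 ω,
    fun ω ω' hw => le_of_tendsto_of_tendsto' (h ω') (h ω) fun n => (hf n).2 _ _ hw⟩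

lemma Good.add {d : ℕ} {f g : EuclideanSpace ℝ (Fin d) → ℝ} (hf : Good f) (hg : Good g) :
    Good (fun x => f x + g x) := by
  obtain ⟨hfc, ⟨A, hA⟩, hf⟩ := hf
  obtain ⟨hgc, ⟨B, hB⟩, hg⟩ := hg
  refine ⟨hfc.add hgc, ⟨A + B, fun x => (abs_add_le _ _).trans (add_le_add (hA x) (hB x))⟩, fun t ht => ?_⟩
  convert (hf t ht).add (hg t ht) using 2 with ω
  unfold cosT
  rw [← integral_add (Good.integrable hfc hA ht ω) (Good.integrable hgc hB ht ω)]
  congr 1; ext x; ring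

lemma Good.const_mul {d : ℕ} {f : EuclideanSpace ℝ (Fin d) → ℝ} (hf : Good f) {c : ℝ} (hc : 0 ≤ c) :
    Good (fun x => c * f x) := by
  obtain ⟨hfc, ⟨A, hA⟩, hf⟩ := hf
  refine ⟨continuous_const.mul hfc, ⟨c * A, fun x => ?_⟩, fun t ht => ?_⟩
  · rw [abs_mul, abs_of_nonneg hc]; exact mul_le_mul_of_nonneg_left (hA x) hc
  convert (hf t ht).const_mul hc using 2 with ω
  unfold cosT
  rw [← integral_const_mul]
  congr 1; ext x; ring

lemma Good.lim {d : ℕ} {f : ℕ → EuclideanSpace ℝ (Fin d) → ℝ} (hf : ∀ n, Good (f n))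
    {g : EuclideanSpace ℝ (Fin d) → ℝ} (hg : Continuous g) {C : ℝ} (hC : ∀ n x, |f n x| ≤ C)
    (h : ∀ x, Filter.Tendsto (fun n => f n x) Filter.atTop (nhds (g x))) : Good g := by
  have hgC : ∀ x, |g x| ≤ C := fun x => le_of_tendsto' (h x).abs fun n => hC n x
  refine ⟨hg, ⟨C, hgC⟩, fun t ht => ?_⟩
  refine NNA.lim (fun n => (hf n).2.2 t ht) fun ω => ?_
  unfold cosT
  refine tendsto_integral_of_dominated_convergence (fun x => C * Real.exp (-t * ‖x‖ ^ 2))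
    (fun n => (Good.integrable (hf n).1 (hC n) ht ω).aestronglyMeasurable)
    ((gauss_integrable ht).const_mul C) (fun n => Filter.Eventually.of_forall fun x => ?_)
    (Filter.Eventually.of_forall fun x => ((h x).mul_const _).mul_const _)
  rw [norm_mul, norm_mul, Real.norm_eq_abs, Real.norm_eq_abs, Real.norm_eq_abs, Real.abs_exp]
  have := Real.abs_cos_le_one ⟪ω, x⟫
  have h1 := hC n x
  calc _ ≤ |f n x| * Real.exp (-t * ‖x‖ ^ 2) * 1 := by gcongr
    _ ≤ _ := by rw [mul_one]; gcongr

lemma Good.lim_cosT {d : ℕ} {k : EuclideanSpace ℝ (Fin d) → ℝ} (hk : Good k) (hi : Integrable k) :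
    NNA (cosT k) := by
  refine NNA.lim (f := fun n : ℕ => cosT (fun x => k x * Real.exp (-(1 / ((n : ℝ) + 1)) * ‖x‖ ^ 2)))
    (fun n => hk.2.2 _ (by positivity)) fun ω => ?_
  unfold cosT
  have hc := hk.1
  refine tendsto_integral_of_dominated_convergence (fun x => ‖k x‖)
    (fun n => Continuous.aestronglyMeasurable (by fun_prop))
    hi.norm (fun n => Filter.Eventually.of_forall fun x => ?_)
    (Filter.Eventually.of_forall fun x => ?_)
  · rw [norm_mul, norm_mul]
    have h1 : ‖Real.exp (-(1 / ((n : ℝ) + 1)) * ‖x‖ ^ 2)‖ ≤ 1 := by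
      rw [Real.norm_eq_abs, Real.abs_exp, Real.exp_le_one_iff]
      have : 0 ≤ (1 / ((n : ℝ) + 1)) * ‖x‖ ^ 2 := by positivity
      linarith
    have h2 : ‖Real.cos ⟪ω, x⟫‖ ≤ 1 := Real.abs_cos_le_one _
    calc _ ≤ ‖k x‖ * 1 * 1 := by gcongr
      _ = _ := by ring
  · refine Filter.Tendsto.mul_const _ ?_
    have h1 := (tendsto_one_div_add_atTop_nhds_zero_nat (𝕜 := ℝ)).neg.mul_const (‖x‖ ^ 2)
    have h2 := (Real.continuous_exp.tendsto _).comp h1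
    have h3 := h2.const_mul (k x)
    simpa using h3

/-- Laplace transform of a finite measure, as a radial function. -/
noncomputable def lapl {d : ℕ} (ν : Measure ℝ) (x : EuclideanSpace ℝ (Fin d)) : ℝ :=
  ∫ s, Real.exp (-s * ‖x‖ ^ 2) ∂ν

lemma lapl_bound {ν : Measure ℝ} [IsFiniteMeasure ν] (hν : ∀ᵐ s ∂ν, 0 < s) {r : ℝ} (hr : 0 ≤ r) :
   ∀ᵐ s ∂ν, ‖Real.exp (-s * r)‖ ≤ 1 := by
  filter_upwards [hν] with s hs
  rw [Real.norm_eq_abs, Real.abs_exp, Real.exp_le_one_iff]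
  have : 0 ≤ s * r := by positivity
  linarith

lemma lapl_cont {d : ℕ} {ν : Measure ℝ} [IsFiniteMeasure ν] (hν : ∀ᵐ s ∂ν, 0 < s) :
    Continuous (lapl (d := d) ν) := by
  unfold lapl
  refine continuous_of_dominated (bound := fun _ => 1)
    (fun x => Continuous.aestronglyMeasurable (by fun_prop))
    (fun x => lapl_bound hν (by positivity)) (integrable_const _)
    (Filter.Eventually.of_forall fun s => by fun_prop)

lemma lapl_nonneg {d : ℕ} {ν : Measure ℝ} (x : EuclideanSpace ℝ (Fin d)) : 0 ≤ lapl ν x :=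
  integral_nonneg fun s => by positivity

lemma lapl_le {d : ℕ} {ν : Measure ℝ} [IsFiniteMeasure ν] (hν : ∀ᵐ s ∂ν, 0 < s)
    (x : EuclideanSpace ℝ (Fin d)) : lapl ν x ≤ ν.real Set.univ := by
  have := norm_integral_le_of_norm_le_const (lapl_bound hν (r := ‖x‖ ^ 2) (by positivity))
  rw [one_mul] at this
  exact (le_abs_self _).trans this

lemma Good.mul_lapl {d : ℕ} {f : EuclideanSpace ℝ (Fin d) → ℝ} (hf : Good f)
    {ν : Measure ℝ} [IsFiniteMeasure ν] (hν : ∀ᵐ s ∂ν, 0 < s) :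
    Good (fun x => f x * lapl ν x) := by
  obtain ⟨hfc, ⟨A, hA⟩, hf⟩ := hf
  have hA0 : 0 ≤ A := (abs_nonneg _).trans (hA 0)
  refine ⟨hfc.mul (lapl_cont hν), ⟨A * ν.real Set.univ, fun x => ?_⟩, fun t ht => ?_⟩
  · rw [abs_mul, abs_of_nonneg (lapl_nonneg x)]
    exact mul_le_mul (hA x) (lapl_le hν x) (lapl_nonneg x) hA0
  have hint : ∀ ω : EuclideanSpace ℝ (Fin d), Integrable (Function.uncurry
      fun (x : EuclideanSpace ℝ (Fin d)) (s : ℝ) =>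
      f x * Real.exp (-(t + s) * ‖x‖ ^ 2) * Real.cos ⟪ω, x⟫) (volume.prod ν) := by
    intro ω
    have h0 : Integrable (fun z : EuclideanSpace ℝ (Fin d) × ℝ =>
        (A * Real.exp (-t * ‖z.1‖ ^ 2)) * 1) (volume.prod ν) :=
      Integrable.mul_prod ((gauss_integrable ht).const_mul A) (integrable_const (1 : ℝ))
    refine h0.mono' (Continuous.aestronglyMeasurable (by unfold Function.uncurry; fun_prop)) ?_
    have hν' : ∀ᵐ z ∂((volume : Measure (EuclideanSpace ℝ (Fin d))).prod ν), 0 < z.2 :=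
      Measure.quasiMeasurePreserving_snd.ae hν
    filter_upwards [hν'] with z hz
    simp only [Function.uncurry]
    rw [norm_mul, norm_mul, Real.norm_eq_abs, Real.norm_eq_abs, Real.norm_eq_abs, Real.abs_exp]
    have h2 := Real.abs_cos_le_one ⟪ω, z.1⟫
    have h1 := hA z.1
    gcongr
    linarith
  have key : ∀ ω, cosT (fun x => f x * lapl ν x * Real.exp (-t * ‖x‖ ^ 2)) ω
      = ∫ s, cosT (fun x => f x * Real.exp (-(t + s) * ‖x‖ ^ 2)) ω ∂ν := by
    intro ω
    unfold cosT
    rw [← integral_integral_swap (hint ω)]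
    congr 1; ext x
    unfold lapl
    beta_reduce
    rw [mul_right_comm (f x), mul_right_comm, ← integral_const_mul]
    congr 1; ext s
    rw [show -(t + s) * ‖x‖ ^ 2 = -t * ‖x‖ ^ 2 + -s * ‖x‖ ^ 2 by ring, Real.exp_add]
    ring
  have hint2 : ∀ ω, Integrable (fun s => cosT (fun x => f x * Real.exp (-(t + s) * ‖x‖ ^ 2)) ω) ν :=
    fun ω => (hint ω).integral_prod_right
  constructor
  · intro ω
    rw [key]
    refine integral_nonneg_of_ae ?_
    filter_upwards [hν] with s hs
    exact (hf (t + s) (by linarith)).1 ω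
  · intro ω ω' h
    rw [key, key]
    refine integral_mono_ae (hint2 _) (hint2 _) ?_
    filter_upwards [hν] with s hs
    exact (hf (t + s) (by linarith)).2 ω ω' h

lemma good_lapl_pow {d : ℕ} {ν : Measure ℝ} [IsFiniteMeasure ν] (hν : ∀ᵐ s ∂ν, 0 < s) (n : ℕ) :
    Good (fun x : EuclideanSpace ℝ (Fin d) => lapl ν x ^ n) := by
  induction n with
  | zero => simpa using good_one
  | succ n ih => simpa [pow_succ] using ih.mul_lapl hν

lemma good_exp_lapl {d : ℕ} {ν : Measure ℝ} [IsFiniteMeasure ν] (hν : ∀ᵐ s ∂ν, 0 < s) :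
    Good (fun x : EuclideanSpace ℝ (Fin d) => Real.exp (lapl ν x)) := by
  have hgood : ∀ N : ℕ, Good (fun x : EuclideanSpace ℝ (Fin d) =>
      ∑ n ∈ Finset.range N, lapl ν x ^ n / (n.factorial : ℝ)) := by
    intro N
    induction N with
    | zero => simpa using good_one.const_mul (d := d) le_rfl
    | succ N ih =>
      simp_rw [Finset.sum_range_succ]
      refine ih.add ?_
      have := (good_lapl_pow (d := d) hν N).const_mul (c := 1 / (N.factorial : ℝ)) (by positivity)
      convert this using 2
      ring
  refine Good.lim hgood (Real.continuous_exp.comp (lapl_cont hν)) (C := Real.exp (ν.real Set.univ)) ?_ ?_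
  · intro N x
    rw [abs_of_nonneg (Finset.sum_nonneg fun n _ => by have := lapl_nonneg (ν := ν) x; positivity)]
    exact (Real.sum_le_exp_of_nonneg (lapl_nonneg x) N).trans (Real.exp_le_exp.2 (lapl_le hν x))
  · intro x
    have := NormedSpace.expSeries_div_hasSum_exp (lapl ν x)
    rw [← Real.exp_eq_exp_ℝ] at this
    exact this.tendsto_sum_nat

lemma kernel_integrable {p q s : ℝ} (hp : 0 < p) (hpq : p < q) (hs : 0 ≤ s) :
    IntegrableOn (fun t : ℝ => t ^ (-1 - p) * (1 - Real.exp (-s * t ^ q))) (Set.Ioi 0) := by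
  have hmeas : Measurable (fun t : ℝ => t ^ (-1 - p) * (1 - Real.exp (-s * t ^ q))) := by fun_prop
  have hU : Set.Ioi (0 : ℝ) = Set.Ioc 0 1 ∪ Set.Ioi 1 := by
    rw [Set.Ioc_union_Ioi_eq_Ioi zero_le_one]
  rw [hU]
  refine IntegrableOn.union ?_ ?_
  · have h1 : IntegrableOn (fun t : ℝ => t ^ (q - 1 - p)) (Set.Ioc 0 1) := by
      have := intervalIntegral.intervalIntegrable_rpow' (a := 0) (b := 1) (r := q - 1 - p) (by linarith)
      rwa [intervalIntegrable_iff_integrableOn_Ioc_of_le zero_le_one] at this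
    refine Integrable.mono' (h1.const_mul s) hmeas.aestronglyMeasurable ?_
    refine (ae_restrict_iff' measurableSet_Ioc).2 (Filter.Eventually.of_forall fun t ht => ?_)
    have ht0 : 0 < t := ht.1
    have e1 : 1 - Real.exp (-s * t ^ q) ≤ s * t ^ q := by
      have := Real.add_one_le_exp (-s * t ^ q); linarith
    have e2 : 0 ≤ 1 - Real.exp (-s * t ^ q) := by
      have : Real.exp (-s * t ^ q) ≤ 1 := Real.exp_le_one_iff.2 (by
        have : 0 ≤ s * t ^ q := by positivity
        linarith)
      linarith
    rw [Real.norm_of_nonneg (by positivity)]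
    calc t ^ (-1 - p) * (1 - Real.exp (-s * t ^ q)) ≤ t ^ (-1 - p) * (s * t ^ q) := by gcongr
      _ = s * (t ^ (-1 - p) * t ^ q) := by ring
      _ = s * t ^ (q - 1 - p) := by rw [← Real.rpow_add ht0]; ring_nf
  · have h1 := integrableOn_Ioi_rpow_of_lt (a := -1 - p) (c := 1) (by linarith) one_pos
    refine Integrable.mono' h1 hmeas.aestronglyMeasurable ?_
    refine (ae_restrict_iff' measurableSet_Ioi).2 (Filter.Eventually.of_forall fun t ht => ?_)
    have ht0 : 0 < t := lt_trans one_pos ht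
    have e2 : 0 ≤ 1 - Real.exp (-s * t ^ q) := by
      have : Real.exp (-s * t ^ q) ≤ 1 := Real.exp_le_one_iff.2 (by
        have : 0 ≤ s * t ^ q := by positivity
        linarith)
      linarith
    rw [Real.norm_of_nonneg (by positivity)]
    have := Real.exp_pos (-s * t ^ q)
    calc _ ≤ t ^ (-1 - p) * 1 := by gcongr; linarith
      _ = _ := mul_one _

lemma kernel_integrable_one {α s : ℝ} (h0 : 0 < α) (h1 : α < 1) (hs : 0 ≤ s) :
    IntegrableOn (fun t : ℝ => t ^ (-1 - α) * (1 - Real.exp (-s * t))) (Set.Ioi 0) := by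
  simpa using kernel_integrable h0 h1 hs

lemma kernel_scale {α s : ℝ} (h0 : 0 < α) (hs : 0 ≤ s) :
    ∫ t in Set.Ioi (0 : ℝ), t ^ (-1 - α) * (1 - Real.exp (-s * t))
      = s ^ α * ∫ t in Set.Ioi (0 : ℝ), t ^ (-1 - α) * (1 - Real.exp (-t)) := by
  rcases hs.eq_or_lt with rfl | hs
  · simp [Real.zero_rpow h0.ne']
  have h := integral_comp_mul_left_Ioi' (fun t : ℝ => t ^ (-1 - α) * (1 - Real.exp (-t))) 0 hs
  rw [mul_zero] at h
  rw [← h, smul_eq_mul, ← mul_assoc, ← integral_const_mul]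
  refine setIntegral_congr_fun measurableSet_Ioi fun t ht => ?_
  have ht0 : 0 < t := ht
  rw [Real.mul_rpow hs.le ht0.le, ← mul_assoc, ← mul_assoc]
  have : s ^ α * s * s ^ (-1 - α) = 1 := by
    rw [← Real.rpow_add_one hs.ne', ← Real.rpow_add hs]
    ring_nf; simp
  rw [this, one_mul, neg_mul]

lemma kernel_pos {α : ℝ} (h0 : 0 < α) (h1 : α < 1) :
    0 < ∫ t in Set.Ioi (0 : ℝ), t ^ (-1 - α) * (1 - Real.exp (-t)) := by
  have hpos : ∀ t ∈ Set.Ioi (0 : ℝ), 0 < t ^ (-1 - α) * (1 - Real.exp (-t)) := by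
    intro t ht
    have ht0 : 0 < t := ht
    have : Real.exp (-t) < 1 := by rw [← Real.exp_zero]; exact Real.exp_lt_exp.2 (by linarith)
    have : 0 < 1 - Real.exp (-t) := by linarith
    positivity
  have hi := kernel_integrable_one h0 h1 zero_le_one
  simp only [neg_mul, one_mul] at hi
  rw [setIntegral_pos_iff_support_of_nonneg_ae _ hi]
  · have : Function.support (fun t : ℝ => t ^ (-1 - α) * (1 - Real.exp (-t))) ∩ Set.Ioi 0 = Set.Ioi 0 := by
      refine Set.inter_eq_right.2 fun t ht => (hpos t ht).ne'
    rw [this]; simp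
  · exact (ae_restrict_iff' measurableSet_Ioi).2 (Filter.Eventually.of_forall fun t ht => (hpos t ht).le)

lemma good_trunc {d : ℕ} {α c δ : ℝ} (h0 : 0 < α) (hc : 0 ≤ c) (hδ : 0 < δ) :
    Good (fun x : EuclideanSpace ℝ (Fin d) =>
      Real.exp (-(c * ∫ t in Set.Ioi δ, t ^ (-1 - α) * (1 - Real.exp (-‖x‖ ^ 2 * t))))) := by
  have hw : IntegrableOn (fun t : ℝ => t ^ (-1 - α)) (Set.Ioi δ) :=
    integrableOn_Ioi_rpow_of_lt (by linarith) hδ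
  have hwc : Integrable (fun t : ℝ => c * t ^ (-1 - α)) (volume.restrict (Set.Ioi δ)) := hw.const_mul c
  set ν : Measure ℝ := (volume.restrict (Set.Ioi δ)).withDensity
    (fun t => ENNReal.ofReal (c * t ^ (-1 - α))) with hνdef
  have : IsFiniteMeasure ν := isFiniteMeasure_withDensity_ofReal hwc.2
  have hν : ∀ᵐ s ∂ν, 0 < s := by
    refine (withDensity_absolutelyContinuous _ _).ae_le ?_
    exact (ae_restrict_iff' measurableSet_Ioi).2 (Filter.Eventually.of_forall fun t ht => hδ.trans ht)
  have hint : ∀ f : ℝ → ℝ, ∫ s, f s ∂ν = ∫ t in Set.Ioi δ, (c * t ^ (-1 - α)) * f t := by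
    intro f
    rw [hνdef, integral_withDensity_eq_integral_toReal_smul (by fun_prop) (by simp)]
    refine setIntegral_congr_fun measurableSet_Ioi fun t ht => ?_
    have ht0 : 0 < t := hδ.trans ht
    simp only [smul_eq_mul]
    rw [ENNReal.toReal_ofReal (by positivity)]
  convert (good_exp_lapl (d := d) hν).const_mul (c := Real.exp (-ν.real Set.univ)) (by positivity) using 2 with x
  rw [← Real.exp_add]
  congr 1
  have e1 : ν.real Set.univ = ∫ t in Set.Ioi δ, (c * t ^ (-1 - α)) := by
    have := hint (fun _ => 1)
    simpa using this
  have hI : Integrable (fun t : ℝ => c * t ^ (-1 - α) * Real.exp (-t * ‖x‖ ^ 2))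
      (volume.restrict (Set.Ioi δ)) := by
    refine hwc.mul_bdd (c := 1) (by fun_prop) ?_
    refine (ae_restrict_iff' measurableSet_Ioi).2 (Filter.Eventually.of_forall fun t ht => ?_)
    have ht0 : 0 < t := hδ.trans ht
    rw [Real.norm_eq_abs, Real.abs_exp, Real.exp_le_one_iff]
    have : 0 ≤ t * ‖x‖ ^ 2 := by positivity
    linarith
  unfold lapl
  rw [e1, hint, neg_add_eq_sub, ← integral_sub hI hwc, ← integral_const_mul,
    ← integral_neg]
  congr 1; ext t
  rw [show -‖x‖ ^ 2 * t = -t * ‖x‖ ^ 2 by ring]; ring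

lemma good_gammaExp {d : ℕ} {γ : ℝ} (h0 : 0 < γ) (h2 : γ < 2) :
    Good (fun x : EuclideanSpace ℝ (Fin d) => Real.exp (-‖x‖ ^ γ)) := by
  have ha0 : 0 < γ / 2 := by linarith
  have ha1 : γ / 2 < 1 := by linarith
  have hK := kernel_pos ha0 ha1
  set K := ∫ t in Set.Ioi (0 : ℝ), t ^ (-1 - γ / 2) * (1 - Real.exp (-t)) with hKdef
  refine Good.lim (fun n : ℕ => good_trunc (c := K⁻¹) (δ := 1 / ((n : ℝ) + 1)) ha0
    (by positivity) (by positivity)) ?_ (C := 1) ?_ ?_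
  · exact Real.continuous_exp.comp (continuous_norm.rpow_const fun _ => Or.inr h0.le).neg
  · intro n x
    rw [Real.abs_exp, Real.exp_le_one_iff, neg_nonpos]
    refine mul_nonneg (by positivity) (setIntegral_nonneg measurableSet_Ioi fun t ht => ?_)
    have ht0 : 0 < t := lt_trans (by positivity) ht
    have : Real.exp (-‖x‖ ^ 2 * t) ≤ 1 := Real.exp_le_one_iff.2 (by
      have : 0 ≤ ‖x‖ ^ 2 * t := by positivity
      linarith)
    have : 0 ≤ 1 - Real.exp (-‖x‖ ^ 2 * t) := by linarith
    positivity
  · intro x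
    have hU : (⋃ n : ℕ, Set.Ioi (1 / ((n : ℝ) + 1))) = Set.Ioi (0 : ℝ) := by
      ext t
      simp only [Set.mem_iUnion, Set.mem_Ioi]
      exact ⟨fun ⟨n, hn⟩ => lt_trans (by positivity) hn, fun h => exists_nat_one_div_lt h⟩
    have hT := tendsto_setIntegral_of_monotone (μ := (volume : Measure ℝ))
      (f := fun t : ℝ => t ^ (-1 - γ / 2) * (1 - Real.exp (-‖x‖ ^ 2 * t)))
      (s := fun n : ℕ => Set.Ioi (1 / ((n : ℝ) + 1))) (fun n => measurableSet_Ioi)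
      (fun m n hmn => Set.Ioi_subset_Ioi (one_div_le_one_div_of_le (by positivity)
        (by have : (m : ℝ) ≤ n := by exact_mod_cast hmn
            linarith)))
      (by rw [hU]; exact kernel_integrable_one ha0 ha1 (by positivity))
    rw [hU, kernel_scale ha0 (by positivity), ← hKdef] at hT
    have hT2 := (Real.continuous_exp.tendsto _).comp (hT.const_mul K⁻¹).neg
    have e : K⁻¹ * ((‖x‖ ^ 2) ^ (γ / 2) * K) = ‖x‖ ^ γ := by
      rw [← Real.rpow_natCast, ← Real.rpow_mul (norm_nonneg x), Nat.cast_ofNat,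
        mul_div_cancel₀ γ two_ne_zero]
      field_simp
    rw [e] at hT2
    exact hT2

lemma gammaExp_integrable {d : ℕ} (hd : 1 ≤ d) {γ : ℝ} (h0 : 0 < γ) :
    Integrable (fun x : EuclideanSpace ℝ (Fin d) => Real.exp (-‖x‖ ^ γ)) := by
  have : Nonempty (Fin d) := ⟨⟨0, hd⟩⟩
  rw [integrable_fun_norm_addHaar volume (f := fun r : ℝ => Real.exp (-r ^ γ))]
  have := integrableOn_rpow_mul_exp_neg_rpow (p := γ) (s := ((d - 1 : ℕ) : ℝ))
    (lt_of_lt_of_le (by norm_num) (Nat.cast_nonneg _)) h0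
  simpa using this

lemma nna_gammaExp {d : ℕ} (hd : 1 ≤ d) {γ : ℝ} (h0 : 0 < γ) (h2 : γ < 2) :
    NNA (cosT (fun x : EuclideanSpace ℝ (Fin d) => Real.exp (-‖x‖ ^ γ))) :=
  (good_gammaExp h0 h2).lim_cosT (gammaExp_integrable hd h0)

lemma cosT_cont {d : ℕ} {k : EuclideanSpace ℝ (Fin d) → ℝ} (hi : Integrable k) :
    Continuous (cosT k) := by
  unfold cosT
  refine continuous_of_dominated (bound := fun x => ‖k x‖) (fun ω => ?_)
    (fun ω => Filter.Eventually.of_forall fun x => ?_) hi.norm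
    (Filter.Eventually.of_forall fun x => by fun_prop)
  · exact hi.aestronglyMeasurable.mul (Continuous.aestronglyMeasurable (by fun_prop))
  · rw [norm_mul]
    have h2 : ‖Real.cos ⟪ω, x⟫‖ ≤ 1 := Real.abs_cos_le_one _
    calc _ ≤ ‖k x‖ * 1 := by gcongr
      _ = _ := mul_one _

lemma parseval_gauss {d : ℕ} {k : EuclideanSpace ℝ (Fin d) → ℝ} (hi : Integrable k)
    {R a : ℝ} (hR : 0 < R) (ha : 0 < a) :
    ∫ ξ, cosT k (R • ξ) * Real.exp (-a * ‖ξ‖ ^ 2) =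
      (4 * Real.pi) ^ ((d : ℝ) / 2) * (R ^ d)⁻¹ *
        ∫ y, k ((2 * √a / R) • y) * Real.exp (-1 * ‖y‖ ^ 2) := by
  have hint : Integrable (Function.uncurry
      fun (ξ : EuclideanSpace ℝ (Fin d)) (x : EuclideanSpace ℝ (Fin d)) =>
      k x * Real.cos ⟪R • ξ, x⟫ * Real.exp (-a * ‖ξ‖ ^ 2)) (volume.prod volume) := by
    have h0 := Integrable.mul_prod (gauss_integrable (d := d) ha) hi
    have h1 := h0.mul_bdd (c := 1)
      (g := fun z : EuclideanSpace ℝ (Fin d) × EuclideanSpace ℝ (Fin d) => Real.cos ⟪R • z.1, z.2⟫)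
      (Continuous.aestronglyMeasurable (by fun_prop))
      (Filter.Eventually.of_forall fun z => Real.abs_cos_le_one _)
    refine h1.congr (Filter.Eventually.of_forall fun z => ?_)
    simp only [Function.uncurry]
    ring
  have hr : 0 < 2 * √a / R := by positivity
  set r := 2 * √a / R with hrdef
  have hsq : √a ^ 2 = a := Real.sq_sqrt ha.le
  have e1 : ∫ ξ, cosT k (R • ξ) * Real.exp (-a * ‖ξ‖ ^ 2) =
      ∫ x, (Real.pi / a) ^ ((d : ℝ) / 2) * (k x * Real.exp (-(R ^ 2 / (4 * a)) * ‖x‖ ^ 2)) := by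
    unfold cosT
    simp_rw [← integral_mul_const]
    rw [integral_integral_swap hint]
    congr 1; ext x
    have := gauss_cosT (d := d) ha (R • x)
    rw [norm_smul, Real.norm_of_nonneg hR.le] at this
    rw [show -(R ^ 2 / (4 * a)) * ‖x‖ ^ 2 = -(R * ‖x‖) ^ 2 / (4 * a) by field_simp, mul_left_comm,
      ← this, ← integral_const_mul]
    congr 1; ext ξ
    rw [inner_smul_left, inner_smul_left, real_inner_comm]
    ring
  have e2 := Measure.integral_comp_smul (volume : Measure (EuclideanSpace ℝ (Fin d)))
    (fun x => k x * Real.exp (-(R ^ 2 / (4 * a)) * ‖x‖ ^ 2)) r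
  have e3 : ∀ y : EuclideanSpace ℝ (Fin d),
      -(R ^ 2 / (4 * a)) * ‖r • y‖ ^ 2 = -1 * ‖y‖ ^ 2 := by
    intro y
    rw [norm_smul, Real.norm_of_nonneg hr.le, hrdef]
    field_simp
    rw [hsq]
    ring
  simp_rw [e3] at e2
  rw [e1, integral_const_mul, e2, finrank_euclideanSpace_fin, smul_eq_mul,
    abs_of_pos (by positivity), ← mul_assoc]
  congr 1
  have e4 : (r ^ d)⁻¹ = R ^ d * ((4 * a) ^ ((d : ℝ) / 2))⁻¹ := by
    have : (4 * a) ^ ((d : ℝ) / 2) = (2 * √a) ^ d := by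
      rw [show 4 * a = (2 * √a) ^ 2 by rw [mul_pow, hsq]; norm_num, ← Real.rpow_natCast _ 2,
        ← Real.rpow_mul (by positivity), Nat.cast_ofNat, mul_div_cancel₀ _ two_ne_zero, Real.rpow_natCast]
    rw [this, hrdef, div_pow]
    field_simp
  rw [e4, Real.div_rpow (by positivity) ha.le, Real.mul_rpow (by norm_num) (by positivity),
    Real.mul_rpow (by norm_num) ha.le]
  have h1 : (0:ℝ) < 4 ^ ((d : ℝ) / 2) := by positivity
  have h2 : (0:ℝ) < a ^ ((d : ℝ) / 2) := by positivity
  field_simp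

lemma cosT_integrable {d : ℕ} {k : EuclideanSpace ℝ (Fin d) → ℝ} (hi : Integrable k)
    (hk1 : ∀ x, |k x| ≤ 1) (hn : NNA (cosT k)) : Integrable (cosT k) := by
  have hc := cosT_cont hi
  have hr : Filter.Tendsto (fun n : ℕ => (n : ℝ) + 1) Filter.atTop Filter.atTop :=
    Filter.tendsto_atTop_add_const_right _ _ tendsto_natCast_atTop_atTop
  have hbdd : ∀ ξ, ‖cosT k ξ‖ ≤ cosT k 0 := fun ξ => by
    rw [Real.norm_of_nonneg (hn.1 _)]
    exact hn.2 _ _ (by simp)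
  refine (aecover_ball (μ := volume) (x := (0 : EuclideanSpace ℝ (Fin d))) hr).integrable_of_integral_bounded_of_nonneg_ae
    (Real.exp 1 * ((4 * Real.pi) ^ ((d : ℝ) / 2) *
      ∫ y : EuclideanSpace ℝ (Fin d), Real.exp (-1 * ‖y‖ ^ 2)))
    (fun n => ?_) (Filter.Eventually.of_forall hn.1) (Filter.Eventually.of_forall fun n => ?_)
  · exact (hc.continuousOn.integrableOn_compact (isCompact_closedBall 0 _)).mono_set
      Metric.ball_subset_closedBall
  · set a : ℝ := 1 / ((n : ℝ) + 1) ^ 2 with ha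
    have ha0 : 0 < a := by positivity
    have hp := parseval_gauss hi one_pos ha0
    simp only [one_smul, one_pow, inv_one, mul_one] at hp
    have hI : Integrable (fun ξ => cosT k ξ * Real.exp (-a * ‖ξ‖ ^ 2)) :=
      (gauss_integrable ha0).bdd_mul hc.aestronglyMeasurable (Filter.Eventually.of_forall hbdd)
    calc ∫ ξ in Metric.ball 0 ((n : ℝ) + 1), cosT k ξ
        ≤ ∫ ξ in Metric.ball 0 ((n : ℝ) + 1), Real.exp 1 * (cosT k ξ * Real.exp (-a * ‖ξ‖ ^ 2)) := by
          refine setIntegral_mono_on ?_ (hI.const_mul _).integrableOn measurableSet_ball fun ξ hξ => ?_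
          · exact (hc.continuousOn.integrableOn_compact (isCompact_closedBall 0 _)).mono_set
              Metric.ball_subset_closedBall
          · have h1 : ‖ξ‖ < (n : ℝ) + 1 := by simpa using hξ
            have h2 : a * ‖ξ‖ ^ 2 ≤ 1 := by
              rw [ha, one_div, inv_mul_le_iff₀ (by positivity), mul_one]
              gcongr
            have h3 : 1 ≤ Real.exp 1 * Real.exp (-a * ‖ξ‖ ^ 2) := by
              rw [← Real.exp_add]; exact Real.one_le_exp (by linarith)
            nlinarith [hn.1 ξ]
      _ ≤ ∫ ξ, Real.exp 1 * (cosT k ξ * Real.exp (-a * ‖ξ‖ ^ 2)) := by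
          refine setIntegral_le_integral (hI.const_mul _) (Filter.Eventually.of_forall fun ξ => ?_)
          have := hn.1 ξ
          simp only [Pi.zero_apply]
          positivity
      _ ≤ _ := by
          rw [integral_const_mul, hp]
          refine mul_le_mul_of_nonneg_left (mul_le_mul_of_nonneg_left ?_ (by positivity)) (by positivity)
          refine (Real.le_norm_self _).trans ?_
          refine norm_integral_le_of_norm_le (gauss_integrable one_pos) (Filter.Eventually.of_forall fun y => ?_)
          rw [norm_mul, Real.norm_eq_abs, Real.norm_eq_abs, Real.abs_exp]
          exact mul_le_of_le_one_left (Real.exp_nonneg _) (hk1 _)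

lemma parseval_zero {d : ℕ} {k : EuclideanSpace ℝ (Fin d) → ℝ} (hi : Integrable k)
    (hkc : Continuous k) (hk0 : k 0 = 1)
    (hk1 : ∀ x, |k x| ≤ 1) (hn : NNA (cosT k)) {R : ℝ} (hR : 0 < R) :
    ∫ ξ, cosT k (R • ξ) = (4 * Real.pi) ^ ((d : ℝ) / 2) * (R ^ d)⁻¹ *
        ∫ y : EuclideanSpace ℝ (Fin d), Real.exp (-1 * ‖y‖ ^ 2) := by
  have hc := cosT_cont hi
  have hGI : Integrable (fun ξ => cosT k (R • ξ)) := (cosT_integrable hi hk1 hn).comp_smul hR.ne'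
  have hlim := tendsto_one_div_add_atTop_nhds_zero_nat (𝕜 := ℝ)
  have t1 : Filter.Tendsto (fun n : ℕ => ∫ ξ, cosT k (R • ξ) * Real.exp (-(1 / ((n : ℝ) + 1)) * ‖ξ‖ ^ 2))
      Filter.atTop (nhds (∫ ξ, cosT k (R • ξ))) := by
    refine tendsto_integral_of_dominated_convergence (fun ξ => ‖cosT k (R • ξ)‖)
      (fun n => Continuous.aestronglyMeasurable (by fun_prop)) hGI.norm
      (fun n => Filter.Eventually.of_forall fun ξ => ?_) (Filter.Eventually.of_forall fun ξ => ?_)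
    · rw [norm_mul]
      refine mul_le_of_le_one_right (norm_nonneg _) ?_
      rw [Real.norm_eq_abs, Real.abs_exp, Real.exp_le_one_iff]
      have : 0 ≤ (1 / ((n : ℝ) + 1)) * ‖ξ‖ ^ 2 := by positivity
      linarith
    · have h1 := (hlim.neg.mul_const (‖ξ‖ ^ 2))
      have h3 := ((Real.continuous_exp.tendsto _).comp h1).const_mul (cosT k (R • ξ))
      simpa using h3
  have t2 : Filter.Tendsto (fun n : ℕ => ∫ y, k ((2 * √(1 / ((n : ℝ) + 1)) / R) • y) * Real.exp (-1 * ‖y‖ ^ 2))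
      Filter.atTop (nhds (∫ y : EuclideanSpace ℝ (Fin d), Real.exp (-1 * ‖y‖ ^ 2))) := by
    refine tendsto_integral_of_dominated_convergence (fun y => Real.exp (-1 * ‖y‖ ^ 2))
      (fun n => Continuous.aestronglyMeasurable (by fun_prop)) (gauss_integrable one_pos)
      (fun n => Filter.Eventually.of_forall fun y => ?_) (Filter.Eventually.of_forall fun y => ?_)
    · rw [norm_mul, Real.norm_eq_abs, Real.norm_eq_abs, Real.abs_exp]
      exact mul_le_of_le_one_left (Real.exp_nonneg _) (hk1 _)
    · have hcont : Continuous (fun a : ℝ => k ((2 * √a / R) • y) * Real.exp (-1 * ‖y‖ ^ 2)) := by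
        fun_prop
      have h := (hcont.tendsto 0).comp hlim
      have e : k ((2 * √(0 : ℝ) / R) • y) * Real.exp (-1 * ‖y‖ ^ 2) = Real.exp (-1 * ‖y‖ ^ 2) := by
        simp [hk0]
      rw [e] at h
      exact h
  refine tendsto_nhds_unique t1 ?_
  refine (t2.const_mul ((4 * Real.pi) ^ ((d : ℝ) / 2) * (R ^ d)⁻¹)).congr fun n => ?_
  rw [parseval_gauss hi hR (by positivity)]

lemma parseval_diff {d : ℕ} {k : EuclideanSpace ℝ (Fin d) → ℝ} (hi : Integrable k)
    (hkc : Continuous k) (hk0 : k 0 = 1)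
    (hk1 : ∀ x, |k x| ≤ 1) (hn : NNA (cosT k)) {R : ℝ} (hR : 0 < R) :
    ∫ ξ, cosT k (R • ξ) * (1 - Real.exp (-(1 / 4) * ‖ξ‖ ^ 2)) =
      (4 * Real.pi) ^ ((d : ℝ) / 2) * (R ^ d)⁻¹ *
        ∫ y : EuclideanSpace ℝ (Fin d), (1 - k (R⁻¹ • y)) * Real.exp (-1 * ‖y‖ ^ 2) := by
  have hc := cosT_cont hi
  have hGI : Integrable (fun ξ => cosT k (R • ξ)) := (cosT_integrable hi hk1 hn).comp_smul hR.ne'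
  have hI : Integrable (fun ξ => cosT k (R • ξ) * Real.exp (-(1 / 4) * ‖ξ‖ ^ 2)) := by
    refine hGI.mul_bdd (c := 1) (Continuous.aestronglyMeasurable (by fun_prop))
      (Filter.Eventually.of_forall fun ξ => ?_)
    rw [Real.norm_eq_abs, Real.abs_exp, Real.exp_le_one_iff]
    have : 0 ≤ (1 / 4) * ‖ξ‖ ^ 2 := by positivity
    linarith
  have hI2 : Integrable (fun y : EuclideanSpace ℝ (Fin d) => k (R⁻¹ • y) * Real.exp (-1 * ‖y‖ ^ 2)) :=
    (gauss_integrable one_pos).bdd_mul (c := 1) (Continuous.aestronglyMeasurable (by fun_prop))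
      (Filter.Eventually.of_forall fun y => hk1 _)
  have h4 := parseval_gauss hi hR (a := 1 / 4) (by norm_num)
  have hs : 2 * √(1 / 4 : ℝ) / R = R⁻¹ := by
    rw [show (1 / 4 : ℝ) = (1 / 2) ^ 2 by norm_num, Real.sqrt_sq (by norm_num)]
    ring
  rw [hs] at h4
  simp_rw [mul_sub, sub_mul, mul_one, one_mul]
  rw [integral_sub hGI hI, integral_sub (gauss_integrable one_pos) hI2, h4,
    parseval_zero hi hkc hk0 hk1 hn hR, mul_sub]

lemma gammaExp_bounds {d : ℕ} (hd : 1 ≤ d) {γ : ℝ} (h0 : 0 < γ) (h2 : γ < 2) :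
    ∃ A B : ℝ, 0 < A ∧ 0 < B ∧
      (∀ R : ℝ, 1 ≤ R → A ≤ R ^ (γ + d) *
        ∫ ξ, cosT (fun x : EuclideanSpace ℝ (Fin d) => Real.exp (-‖x‖ ^ γ)) (R • ξ) *
          (1 - Real.exp (-(1 / 4) * ‖ξ‖ ^ 2))) ∧
      (∀ R : ℝ, 0 < R → R ^ (γ + d) *
        ∫ ξ, cosT (fun x : EuclideanSpace ℝ (Fin d) => Real.exp (-‖x‖ ^ γ)) (R • ξ) *
          (1 - Real.exp (-(1 / 4) * ‖ξ‖ ^ 2)) ≤ B) := by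
  have hi := gammaExp_integrable hd h0
  have hn := nna_gammaExp hd h0 h2
  have hkc : Continuous (fun x : EuclideanSpace ℝ (Fin d) => Real.exp (-‖x‖ ^ γ)) :=
    (good_gammaExp h0 h2).1
  have hk1 : ∀ x : EuclideanSpace ℝ (Fin d), |Real.exp (-‖x‖ ^ γ)| ≤ 1 := by
    intro x
    rw [Real.abs_exp, Real.exp_le_one_iff]
    have : 0 ≤ ‖x‖ ^ γ := by positivity
    linarith
  have hk0 : Real.exp (-‖(0 : EuclideanSpace ℝ (Fin d))‖ ^ γ) = 1 := by
    simp [Real.zero_rpow h0.ne']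
  have hP := fun (R : ℝ) (hR : 0 < R) => parseval_diff hi hkc hk0 hk1 hn hR
  set e : EuclideanSpace ℝ (Fin d) := EuclideanSpace.single ⟨0, hd⟩ 1 with he
  have hen : ‖e‖ = 1 := by simp [he]
  have hgc : Continuous (fun y : EuclideanSpace ℝ (Fin d) => ‖y‖ ^ γ) :=
    continuous_norm.rpow_const fun _ => Or.inr h0.le
  -- integrability of the comparison functions
  have hsmall : ∀ ε : ℝ, 0 ≤ ε → ∀ y : EuclideanSpace ℝ (Fin d),
      0 ≤ 1 - Real.exp (-(ε * ‖y‖ ^ γ)) ∧ 1 - Real.exp (-(ε * ‖y‖ ^ γ)) ≤ 1 := by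
    intro ε hε y
    have h1 : Real.exp (-(ε * ‖y‖ ^ γ)) ≤ 1 := by
      rw [Real.exp_le_one_iff]
      have : 0 ≤ ε * ‖y‖ ^ γ := by positivity
      linarith
    have h2 := Real.exp_pos (-(ε * ‖y‖ ^ γ))
    constructor <;> linarith
  have hDI : ∀ ε : ℝ, 0 ≤ ε → Integrable (fun y : EuclideanSpace ℝ (Fin d) =>
      (1 - Real.exp (-(ε * ‖y‖ ^ γ))) * Real.exp (-1 * ‖y‖ ^ 2)) := by
    intro ε hε
    refine (gauss_integrable one_pos).bdd_mul (c := 1) (Continuous.aestronglyMeasurable (by fun_prop))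
      (Filter.Eventually.of_forall fun y => ?_)
    rw [Real.norm_of_nonneg (hsmall ε hε y).1]
    exact (hsmall ε hε y).2
  have hMI : Integrable (fun y : EuclideanSpace ℝ (Fin d) => ‖y‖ ^ γ * Real.exp (-1 * ‖y‖ ^ 2)) := by
    have : Nonempty (Fin d) := ⟨⟨0, hd⟩⟩
    rw [integrable_fun_norm_addHaar volume (f := fun r : ℝ => r ^ γ * Real.exp (-1 * r ^ 2))]
    have h := integrableOn_rpow_mul_exp_neg_mul_sq one_pos (s := ((d - 1 : ℕ) : ℝ) + γ)
      (by have : (0 : ℝ) ≤ ((d - 1 : ℕ) : ℝ) := Nat.cast_nonneg _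
          linarith)
    refine h.congr_fun (fun r hr => ?_) measurableSet_Ioi
    have hr0 : 0 < r := hr
    simp only [smul_eq_mul, finrank_euclideanSpace_fin]
    rw [Real.rpow_add hr0, Real.rpow_natCast, mul_assoc]
  have hD1 : 0 < ∫ y : EuclideanSpace ℝ (Fin d),
      (1 - Real.exp (-(1 * ‖y‖ ^ γ))) * Real.exp (-1 * ‖y‖ ^ 2) := by
    refine integral_pos_of_integrable_nonneg_nonzero (x := e) (by fun_prop) (hDI 1 zero_le_one)
      (fun y => mul_nonneg (hsmall 1 zero_le_one y).1 (Real.exp_nonneg _)) ?_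
    rw [hen]
    have : Real.exp (-(1 * (1 : ℝ) ^ γ)) < 1 := by
      rw [← Real.exp_zero]; exact Real.exp_lt_exp.2 (by simp)
    have h3 : 0 < 1 - Real.exp (-(1 * (1 : ℝ) ^ γ)) := by linarith
    positivity
  have hM1 : 0 < ∫ y : EuclideanSpace ℝ (Fin d), ‖y‖ ^ γ * Real.exp (-1 * ‖y‖ ^ 2) := by
    refine integral_pos_of_integrable_nonneg_nonzero (x := e) (by fun_prop) hMI
      (fun y => by simp only [Pi.zero_apply]; positivity) ?_
    rw [hen]
    positivity
  have hform : ∀ R : ℝ, 0 < R → R ^ (γ + d) *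
        ∫ ξ, cosT (fun x : EuclideanSpace ℝ (Fin d) => Real.exp (-‖x‖ ^ γ)) (R • ξ) *
          (1 - Real.exp (-(1 / 4) * ‖ξ‖ ^ 2)) = (4 * Real.pi) ^ ((d : ℝ) / 2) * (R ^ γ *
          ∫ y : EuclideanSpace ℝ (Fin d),
            (1 - Real.exp (-((R ^ γ)⁻¹ * ‖y‖ ^ γ))) * Real.exp (-1 * ‖y‖ ^ 2)) := by
    intro R hR
    rw [hP R hR, Real.rpow_add hR, Real.rpow_natCast]
    have : ∀ y : EuclideanSpace ℝ (Fin d), ‖R⁻¹ • y‖ ^ γ = (R ^ γ)⁻¹ * ‖y‖ ^ γ := by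
      intro y
      rw [norm_smul, Real.norm_of_nonneg (by positivity), Real.mul_rpow (by positivity) (by positivity),
        Real.inv_rpow hR.le]
    simp_rw [this]
    field_simp
  refine ⟨_, _, mul_pos (by positivity : 0 < (4 * Real.pi) ^ ((d : ℝ) / 2)) hD1,
    mul_pos (by positivity : 0 < (4 * Real.pi) ^ ((d : ℝ) / 2)) hM1, fun R hR => ?_, fun R hR => ?_⟩
  · have hR0 : 0 < R := by linarith
    rw [hform R hR0]
    gcongr
    rw [← integral_const_mul]
    refine integral_mono (hDI 1 zero_le_one) ((hDI _ (by positivity)).const_mul _) fun y => ?_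
    simp only
    rw [← mul_assoc]
    gcongr
    have hRg : 1 ≤ R ^ γ := Real.one_le_rpow hR h0.le
    have hRg0 : 0 < R ^ γ := by positivity
    -- convexity of exp
    have hconv := convexOn_exp.2 (Set.mem_univ (-(1 * ‖y‖ ^ γ))) (Set.mem_univ (0 : ℝ))
      (show 0 ≤ (R ^ γ)⁻¹ by positivity)
      (show 0 ≤ 1 - (R ^ γ)⁻¹ by
        have := inv_le_one_of_one_le₀ hRg
        linarith) (by ring)
    simp only [smul_eq_mul, mul_zero, add_zero, Real.exp_zero, mul_one, one_mul, mul_neg] at hconv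
    have h5 := mul_le_mul_of_nonneg_left hconv hRg0.le
    rw [mul_add, mul_sub, mul_inv_cancel_left₀ hRg0.ne', mul_inv_cancel₀ hRg0.ne'] at h5
    rw [one_mul]
    linarith
  · rw [hform R hR]
    gcongr
    rw [← integral_const_mul]
    refine integral_mono ((hDI _ (by positivity)).const_mul _) hMI fun y => ?_
    simp only
    rw [← mul_assoc]
    gcongr
    have hRg0 : 0 < R ^ γ := by positivity
    have h6 := Real.add_one_le_exp (-((R ^ γ)⁻¹ * ‖y‖ ^ γ))
    have h7 : 1 - Real.exp (-((R ^ γ)⁻¹ * ‖y‖ ^ γ)) ≤ (R ^ γ)⁻¹ * ‖y‖ ^ γ := by linarith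
    calc _ ≤ R ^ γ * ((R ^ γ)⁻¹ * ‖y‖ ^ γ) := by gcongr
      _ = _ := mul_inv_cancel_left₀ hRg0.ne' _

lemma weight_bounds {d : ℕ} (ξ : EuclideanSpace ℝ (Fin d)) :
    0 ≤ 1 - Real.exp (-(1 / 4) * ‖ξ‖ ^ 2) ∧ 1 - Real.exp (-(1 / 4) * ‖ξ‖ ^ 2) ≤ 1 := by
  have h1 : Real.exp (-(1 / 4) * ‖ξ‖ ^ 2) ≤ 1 := by
    rw [Real.exp_le_one_iff]
    have : 0 ≤ (1 / 4) * ‖ξ‖ ^ 2 := by positivity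
    linarith
  have h2 := Real.exp_pos (-(1 / 4) * ‖ξ‖ ^ 2)
  constructor <;> linarith

/-- Abstract Tauberian upper bound. -/
lemma taub_upper {d : ℕ} (hd : 1 ≤ d) {p : ℝ} {G : EuclideanSpace ℝ (Fin d) → ℝ}
    (hn : NNA G) (hG : Integrable G) {B : ℝ} (hB : 0 < B)
    (h : ∀ R : ℝ, 0 < R → R ^ p * ∫ ξ, G (R • ξ) * (1 - Real.exp (-(1 / 4) * ‖ξ‖ ^ 2)) ≤ B) :
    ∃ C, 0 < C ∧ ∀ ω, ω ≠ 0 → G ω ≤ C * ‖ω‖ ^ (-p) := by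
  set b : EuclideanSpace ℝ (Fin d) → ℝ :=
    fun ξ => (1 - Real.exp (-(1 / 4) * ‖ξ‖ ^ 2)) * max 0 (1 - ‖ξ‖) with hb
  have hbc : Continuous b := by fun_prop
  have hbs : HasCompactSupport b := by
    refine HasCompactSupport.intro (isCompact_closedBall 0 1) fun x hx => ?_
    have : 1 < ‖x‖ := by simpa using hx
    simp only [hb]
    rw [max_eq_left (by linarith), mul_zero]
  have hb0 : 0 ≤ b := fun ξ => mul_nonneg (weight_bounds ξ).1 (le_max_left _ _)
  set e : EuclideanSpace ℝ (Fin d) := EuclideanSpace.single ⟨0, hd⟩ (1 / 2) with he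
  have hen : ‖e‖ = 1 / 2 := by simp [he]
  have hc : 0 < ∫ ξ, b ξ := by
    refine hbc.integral_pos_of_hasCompactSupport_nonneg_nonzero hbs hb0 (x := e) ?_
    simp only [hb, hen]
    have : Real.exp (-(1 / 4) * (1 / 2 : ℝ) ^ 2) < 1 := by
      rw [← Real.exp_zero]; exact Real.exp_lt_exp.2 (by norm_num)
    have h3 : 0 < 1 - Real.exp (-(1 / 4) * (1 / 2 : ℝ) ^ 2) := by linarith
    have h4 : 0 < max (0 : ℝ) (1 - 1 / 2) := by norm_num
    positivity
  refine ⟨B / ∫ ξ, b ξ, by positivity, fun ω hω => ?_⟩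
  have hR : 0 < ‖ω‖ := norm_pos_iff.2 hω
  have hh := h ‖ω‖ hR
  have hle : ∫ ξ, G ω * b ξ ≤ ∫ ξ, G (‖ω‖ • ξ) * (1 - Real.exp (-(1 / 4) * ‖ξ‖ ^ 2)) := by
    refine integral_mono ((hbc.integrable_of_hasCompactSupport hbs).const_mul _) ?_ fun ξ => ?_
    · refine (hG.comp_smul hR.ne').mul_bdd (c := 1) (Continuous.aestronglyMeasurable (by fun_prop))
        (Filter.Eventually.of_forall fun ξ => ?_)
      rw [Real.norm_of_nonneg (weight_bounds ξ).1]
      exact (weight_bounds ξ).2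
    · simp only [hb]
      have hw := (weight_bounds ξ).1
      rcases le_total ‖ξ‖ 1 with h1 | h1
      · have h2 : G ω ≤ G (‖ω‖ • ξ) := hn.2 _ _ (by
          rw [norm_smul, norm_norm]; exact mul_le_of_le_one_right hR.le h1)
        have h3 : max 0 (1 - ‖ξ‖) ≤ 1 := max_le zero_le_one (by have := norm_nonneg ξ; linarith)
        calc _ ≤ G ω * ((1 - Real.exp (-(1 / 4) * ‖ξ‖ ^ 2)) * 1) := by
              have := hn.1 ω
              gcongr
          _ ≤ _ := by rw [mul_one]; gcongr
      · rw [max_eq_left (by linarith), mul_zero, mul_zero]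
        exact mul_nonneg (hn.1 _) hw
  rw [integral_const_mul] at hle
  rw [Real.rpow_neg hR.le, ← div_eq_mul_inv, le_div_iff₀ (by positivity), le_div_iff₀ hc]
  calc G ω * ‖ω‖ ^ p * ∫ ξ, b ξ = ‖ω‖ ^ p * (G ω * ∫ ξ, b ξ) := by ring
    _ ≤ ‖ω‖ ^ p * ∫ ξ, G (‖ω‖ • ξ) * (1 - Real.exp (-(1 / 4) * ‖ξ‖ ^ 2)) := by gcongr
    _ ≤ B := hh

/-- Abstract Tauberian lower bound. -/
lemma taub_lower {d : ℕ} (hd : 1 ≤ d) {γ : ℝ} (h0 : 0 < γ) (h2 : γ < 2)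
    {G : EuclideanSpace ℝ (Fin d) → ℝ}
    (hn : NNA G) (hG : Integrable G) {A : ℝ} (hA : 0 < A)
    (h : ∀ R : ℝ, 1 ≤ R → A ≤ R ^ (γ + d) * ∫ ξ, G (R • ξ) * (1 - Real.exp (-(1 / 4) * ‖ξ‖ ^ 2)))
    {C : ℝ} (hC : ∀ ω, ω ≠ 0 → G ω ≤ C * ‖ω‖ ^ (-(γ + d))) :
    ∃ c, 0 < c ∧ ∀ ω, 1 ≤ ‖ω‖ → c * ‖ω‖ ^ (-(γ + d)) ≤ G ω := by
  have hne : Nonempty (Fin d) := ⟨⟨0, hd⟩⟩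
  set g : EuclideanSpace ℝ (Fin d) → ℝ :=
    fun ξ => C * (‖ξ‖ ^ (-(γ + d)) * (1 - Real.exp (-(1 / 4) * ‖ξ‖ ^ 2))) with hg
  have hgI : Integrable g := by
    refine Integrable.const_mul ?_ C
    rw [integrable_fun_norm_addHaar volume
      (f := fun r : ℝ => r ^ (-(γ + d)) * (1 - Real.exp (-(1 / 4) * r ^ 2)))]
    have hk := kernel_integrable h0 h2 (s := 1 / 4) (by norm_num)
    refine hk.congr_fun (fun r hr => ?_) measurableSet_Ioi
    have hr0 : 0 < r := hr
    simp only [smul_eq_mul, finrank_euclideanSpace_fin]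
    rw [← mul_assoc, ← Real.rpow_natCast r (d - 1), ← Real.rpow_add hr0, Nat.cast_sub hd, Real.rpow_two]
    congr 2
    push_cast
    ring
  set S : ℕ → Set (EuclideanSpace ℝ (Fin d)) :=
    fun n => {ξ | 1 / ((n : ℝ) + 1) ≤ ‖ξ‖ ∧ ‖ξ‖ ≤ (n : ℝ) + 1} with hS
  have hSm : ∀ n, MeasurableSet (S n) := fun n =>
    (measurableSet_le measurable_const measurable_norm).inter
      (measurableSet_le measurable_norm measurable_const)
  have hU : (⋃ n, S n) = {0}ᶜ := by
    ext ξ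
    simp only [hS, Set.mem_iUnion, Set.mem_ofPred_eq, Set.mem_compl_iff, Set.mem_singleton_iff]
    constructor
    · rintro ⟨n, hn1, -⟩ rfl
      rw [norm_zero] at hn1
      have : 0 < 1 / ((n : ℝ) + 1) := by positivity
      linarith
    · intro hξ
      obtain ⟨n, hn⟩ := exists_nat_one_div_lt (norm_pos_iff.2 hξ)
      obtain ⟨m, hm⟩ := exists_nat_ge ‖ξ‖
      refine ⟨max n m, ?_, ?_⟩
      · refine le_trans (one_div_le_one_div_of_le (by positivity) ?_) hn.le
        have : (n : ℝ) ≤ (max n m : ℕ) := by exact_mod_cast le_max_left n m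
        linarith
      · have : (m : ℝ) ≤ (max n m : ℕ) := by exact_mod_cast le_max_right n m
        linarith
  have hmono : Monotone S := by
    intro m n hmn ξ hξ
    have : (m : ℝ) ≤ n := by exact_mod_cast hmn
    refine ⟨le_trans (one_div_le_one_div_of_le (by positivity) (by linarith)) hξ.1, hξ.2.trans (by linarith)⟩
  have hT := tendsto_setIntegral_of_monotone (μ := volume) (f := g) hSm hmono hgI.integrableOn
  have hU0 : ∫ ξ in (⋃ n, S n), g ξ = ∫ ξ, g ξ := by
    rw [hU]
    refine setIntegral_eq_integral_of_forall_compl_eq_zero fun ξ hξ => ?_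
    have : ξ = 0 := by simpa using hξ
    simp [hg, this]
  rw [hU0] at hT
  obtain ⟨n, hn'⟩ := (hT.eventually (lt_mem_nhds
    (show (∫ ξ, g ξ) - A / 2 < ∫ ξ, g ξ by linarith))).exists
  have hsplit := integral_add_compl (hSm n) hgI
  have hcompl : ∫ ξ in (S n)ᶜ, g ξ < A / 2 := by linarith
  have hVfin : volume (S n) < ⊤ := by
    refine lt_of_le_of_lt (measure_mono (t := Metric.closedBall 0 ((n : ℝ) + 1)) fun ξ hξ => ?_)
      measure_closedBall_lt_top
    simpa using hξ.2
  set V : ℝ := volume.real (S n) with hV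
  have hV0 : 0 ≤ V := measureReal_nonneg
  have hN : (0 : ℝ) < (n : ℝ) + 1 := by positivity
  refine ⟨A / 2 / ((V + 1) * ((n : ℝ) + 1) ^ (γ + d)), by positivity, fun ω hω => ?_⟩
  have hω0 : 0 < ‖ω‖ := by linarith
  set R : ℝ := ‖ω‖ * ((n : ℝ) + 1) with hRdef
  have hR1 : 1 ≤ R := by
    have : (1 : ℝ) ≤ (n : ℝ) + 1 := by
      have : (0 : ℝ) ≤ n := Nat.cast_nonneg n
      linarith
    exact one_le_mul_of_one_le_of_one_le hω this
  have hR0 : 0 < R := by linarith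
  have hRp : 0 < R ^ (γ + d) := by positivity
  have hFI : Integrable (fun ξ => G (R • ξ) * (1 - Real.exp (-(1 / 4) * ‖ξ‖ ^ 2))) := by
    refine (hG.comp_smul hR0.ne').mul_bdd (c := 1) (Continuous.aestronglyMeasurable (by fun_prop))
      (Filter.Eventually.of_forall fun ξ => ?_)
    rw [Real.norm_of_nonneg (weight_bounds ξ).1]
    exact (weight_bounds ξ).2
  have hA1 := h R hR1
  rw [← integral_add_compl (hSm n) hFI, mul_add] at hA1
  have hout : R ^ (γ + d) * ∫ ξ in (S n)ᶜ, G (R • ξ) * (1 - Real.exp (-(1 / 4) * ‖ξ‖ ^ 2))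
      ≤ ∫ ξ in (S n)ᶜ, g ξ := by
    rw [← integral_const_mul]
    refine setIntegral_mono (hFI.const_mul _).integrableOn hgI.integrableOn fun ξ => ?_
    simp only [hg]
    rcases eq_or_ne ξ 0 with rfl | hξ
    · simp
    have h1 := hC (R • ξ) (smul_ne_zero hR0.ne' hξ)
    rw [norm_smul, Real.norm_of_nonneg hR0.le, Real.mul_rpow hR0.le (norm_nonneg _),
      Real.rpow_neg hR0.le] at h1
    rw [← mul_assoc, ← mul_assoc]
    refine mul_le_mul_of_nonneg_right ?_ (weight_bounds ξ).1
    calc R ^ (γ + d) * G (R • ξ) ≤ R ^ (γ + d) * (C * ((R ^ (γ + d))⁻¹ * ‖ξ‖ ^ (-(γ + d)))) := by gcongr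
      _ = C * ‖ξ‖ ^ (-(γ + d)) := by field_simp
  have hin : ∫ ξ in S n, G (R • ξ) * (1 - Real.exp (-(1 / 4) * ‖ξ‖ ^ 2)) ≤ G ω * (V + 1) := by
    calc _ ≤ ∫ ξ in S n, G ω := by
          refine setIntegral_mono_on hFI.integrableOn (integrableOn_const hVfin.ne) (hSm n) fun ξ hξ => ?_
          have h1 : G (R • ξ) ≤ G ω := by
            refine hn.2 _ _ ?_
            rw [norm_smul, Real.norm_of_nonneg hR0.le, hRdef, mul_assoc]
            refine le_mul_of_one_le_right hω0.le ?_
            have := hξ.1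
            rwa [div_le_iff₀ hN, mul_comm] at this
          calc _ ≤ G (R • ξ) * 1 := by
                have := hn.1 (R • ξ)
                have := (weight_bounds ξ).2
                gcongr
            _ ≤ _ := by rwa [mul_one]
      _ = V * G ω := by simp [hV]
      _ ≤ _ := by have := hn.1 ω; nlinarith
  have hin2 := mul_le_mul_of_nonneg_left hin hRp.le
  have hfin : A / 2 ≤ R ^ (γ + d) * (G ω * (V + 1)) := by linarith
  rw [Real.rpow_neg hω0.le, ← div_eq_mul_inv, div_div, div_le_iff₀ (by positivity)]
  rw [hRdef, Real.mul_rpow hω0.le hN.le] at hfin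
  calc A / 2 ≤ _ := hfin
    _ = _ := by ring

theorem gammaExponential_fourier_polynomial_decay (d : ℕ) (hd : 1 ≤ d)
    (γ : ℝ) (hγ0 : 0 < γ) (hγ2 : γ < 2) :
    (∀ ω : EuclideanSpace ℝ (Fin d),
      (∫ x : EuclideanSpace ℝ (Fin d),
          ((Real.exp (-‖x‖ ^ γ) : ℝ) : ℂ) *
            Complex.exp (-Complex.I * ((⟪ω, x⟫ : ℝ) : ℂ))).im = 0) ∧
    ∃ C₁ C₂ : ℝ, 0 < C₁ ∧ 0 < C₂ ∧
      ∀ ω : EuclideanSpace ℝ (Fin d),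
        C₁ * (1 + ‖ω‖) ^ (-(γ + d)) ≤
          (∫ x : EuclideanSpace ℝ (Fin d),
              ((Real.exp (-‖x‖ ^ γ) : ℝ) : ℂ) *
                Complex.exp (-Complex.I * ((⟪ω, x⟫ : ℝ) : ℂ))).re ∧
        (∫ x : EuclideanSpace ℝ (Fin d),
            ((Real.exp (-‖x‖ ^ γ) : ℝ) : ℂ) *
              Complex.exp (-Complex.I * ((⟪ω, x⟫ : ℝ) : ℂ))).re ≤
          C₂ * (1 + ‖ω‖) ^ (-(γ + d)) := by
  have hi := gammaExp_integrable hd hγ0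
  have hI : ∀ ω : EuclideanSpace ℝ (Fin d), Integrable (fun x : EuclideanSpace ℝ (Fin d) =>
      ((Real.exp (-‖x‖ ^ γ) : ℝ) : ℂ) * Complex.exp (-Complex.I * ((⟪ω, x⟫ : ℝ) : ℂ))) := by
    intro ω
    refine hi.ofReal.mul_bdd (c := 1) (Continuous.aestronglyMeasurable (by fun_prop))
      (Filter.Eventually.of_forall fun x => ?_)
    rw [Complex.norm_exp]
    simp
  have hform : ∀ (ω x : EuclideanSpace ℝ (Fin d)), Complex.exp (-Complex.I * ((⟪ω, x⟫ : ℝ) : ℂ)) =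
      ((Real.cos ⟪ω, x⟫ : ℝ) : ℂ) - ((Real.sin ⟪ω, x⟫ : ℝ) : ℂ) * Complex.I := by
    intro ω x
    rw [show -Complex.I * ((⟪ω, x⟫ : ℝ) : ℂ) = (((-⟪ω, x⟫ : ℝ)) : ℂ) * Complex.I by push_cast; ring,
      Complex.exp_mul_I, ← Complex.ofReal_cos, ← Complex.ofReal_sin, Real.cos_neg, Real.sin_neg]
    push_cast
    ring
  have hre : ∀ ω : EuclideanSpace ℝ (Fin d), (∫ x : EuclideanSpace ℝ (Fin d),
      ((Real.exp (-‖x‖ ^ γ) : ℝ) : ℂ) * Complex.exp (-Complex.I * ((⟪ω, x⟫ : ℝ) : ℂ))).re =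
      cosT (fun x => Real.exp (-‖x‖ ^ γ)) ω := by
    intro ω
    have h := integral_re (hI ω)
    simp only [RCLike.re_to_complex] at h
    rw [← h, cosT]
    congr 1; ext x
    rw [hform, Complex.re_ofReal_mul]
    simp [← Complex.ofReal_cos, ← Complex.ofReal_sin]
  have him : ∀ ω : EuclideanSpace ℝ (Fin d), (∫ x : EuclideanSpace ℝ (Fin d),
      ((Real.exp (-‖x‖ ^ γ) : ℝ) : ℂ) * Complex.exp (-Complex.I * ((⟪ω, x⟫ : ℝ) : ℂ))).im = 0 := by
    intro ω
    have h := integral_im (hI ω)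
    simp only [RCLike.im_to_complex] at h
    rw [← h]
    have e1 : ∀ x : EuclideanSpace ℝ (Fin d), (((Real.exp (-‖x‖ ^ γ) : ℝ) : ℂ) *
        Complex.exp (-Complex.I * ((⟪ω, x⟫ : ℝ) : ℂ))).im
        = -(Real.exp (-‖x‖ ^ γ) * Real.sin ⟪ω, x⟫) := by
      intro x
      rw [hform, Complex.im_ofReal_mul]
      simp [← Complex.ofReal_sin, ← Complex.ofReal_cos]
    simp_rw [e1]
    have h2 := integral_neg_eq_self
      (fun x : EuclideanSpace ℝ (Fin d) => -(Real.exp (-‖x‖ ^ γ) * Real.sin ⟪ω, x⟫)) volume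
    simp only [norm_neg, inner_neg_right, Real.sin_neg, mul_neg, neg_neg] at h2
    rw [integral_neg] at h2 ⊢
    linarith
  refine ⟨him, ?_⟩
  simp_rw [hre]
  have hn := nna_gammaExp hd hγ0 hγ2
  have hk1 : ∀ x : EuclideanSpace ℝ (Fin d), |Real.exp (-‖x‖ ^ γ)| ≤ 1 := by
    intro x
    rw [Real.abs_exp, Real.exp_le_one_iff]
    have : 0 ≤ ‖x‖ ^ γ := by positivity
    linarith
  have hG := cosT_integrable hi hk1 hn
  obtain ⟨A, B, hA, hB, hlow, hupp⟩ := gammaExp_bounds hd hγ0 hγ2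
  obtain ⟨C, hC0, hC⟩ := taub_upper hd hn hG hB hupp
  obtain ⟨c, hc0, hc⟩ := taub_lower hd hγ0 hγ2 hn hG hA hlow hC
  set G := cosT (fun x : EuclideanSpace ℝ (Fin d) => Real.exp (-‖x‖ ^ γ)) with hGdef
  have hp : 0 < γ + d := by positivity
  set e : EuclideanSpace ℝ (Fin d) := EuclideanSpace.single ⟨0, hd⟩ 1 with he
  have hen : ‖e‖ = 1 := by simp [he]
  have hG0 : 0 ≤ G 0 := hn.1 0
  refine ⟨c, (C + G 0) * 2 ^ (γ + d), hc0, by positivity, fun ω => ⟨?_, ?_⟩⟩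
  · rcases le_total 1 ‖ω‖ with h1 | h1
    · refine le_trans ?_ (hc ω h1)
      refine mul_le_mul_of_nonneg_left ?_ hc0.le
      exact Real.rpow_le_rpow_of_nonpos (by linarith) (by linarith) (by linarith)
    · have h3 := hc e hen.ge
      rw [hen, Real.one_rpow] at h3
      have h4 : G e ≤ G ω := hn.2 _ _ (by rw [hen]; exact h1)
      refine le_trans ?_ (h3.trans h4)
      refine mul_le_mul_of_nonneg_left ?_ hc0.le
      exact Real.rpow_le_one_of_one_le_of_nonpos (by have := norm_nonneg ω; linarith) (by linarith)
  · have h1w : 0 < 1 + ‖ω‖ := by positivity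
    have hkey : ∀ s : ℝ, 0 < s → 1 + ‖ω‖ ≤ 2 * s → s ^ (-(γ + d)) ≤ 2 ^ (γ + d) * (1 + ‖ω‖) ^ (-(γ + d)) := by
      intro s hs hle
      have h5 := Real.rpow_le_rpow_of_nonpos h1w hle (show -(γ + d) ≤ 0 by linarith)
      rw [Real.mul_rpow (by norm_num) hs.le, Real.rpow_neg (by norm_num : (0 : ℝ) ≤ 2),
        inv_mul_le_iff₀ (by positivity)] at h5
      exact h5
    have hpos : 0 < 2 ^ (γ + d) * (1 + ‖ω‖) ^ (-(γ + d)) := by positivity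
    rw [mul_assoc]
    rcases le_total 1 ‖ω‖ with h1 | h1
    · have hω : ω ≠ 0 := norm_pos_iff.1 (by linarith)
      calc G ω ≤ C * ‖ω‖ ^ (-(γ + d)) := hC ω hω
        _ ≤ C * (2 ^ (γ + d) * (1 + ‖ω‖) ^ (-(γ + d))) := by
            refine mul_le_mul_of_nonneg_left (hkey _ (by linarith) (by linarith)) hC0.le
        _ ≤ _ := mul_le_mul_of_nonneg_right (by linarith) hpos.le
    · have h6 := hkey 1 one_pos (by linarith)
      rw [Real.one_rpow] at h6
      have h7 : G ω ≤ G 0 := hn.2 _ _ (by simp)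
      calc G ω ≤ G 0 * 1 := by rwa [mul_one]
        _ ≤ G 0 * (2 ^ (γ + d) * (1 + ‖ω‖) ^ (-(γ + d))) := mul_le_mul_of_nonneg_left h6 hG0
        _ ≤ _ := mul_le_mul_of_nonneg_right (by linarith) hpos.le
end

section
/- Let d ≥ 1 and γ ∈ (0,2]. The γ-exponential kernel is positive definite on ℝ^d: for every n ∈ ℕ, every collection of points x₁, …, xₙ ∈ ℝ^d, and every collection of complex coefficients c₁, …, cₙ ∈ ℂ, the quantity Σ_{i=1}^n Σ_{j=1}^n c_i · conj(c_j) · exp(-‖x_i - x_j‖^γ) is a nonnegative real number (its imaginary part vanishes and its real part is ≥ 0). -/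
open scoped BigOperators

/-- Real positive semidefinite kernels on a finite index set. -/
def GPsd {n : ℕ} (K : Fin n → Fin n → ℝ) : Prop :=
  (∀ i j, K i j = K j i) ∧ ∀ c : Fin n → ℝ, 0 ≤ ∑ i, ∑ j, c i * c j * K i j

/-- Conditionally negative definite kernels on a finite index set. -/
def GCnd {n : ℕ} (K : Fin n → Fin n → ℝ) : Prop :=
  (∀ i j, K i j = K j i) ∧
    ∀ c : Fin n → ℝ, ∑ i, c i = 0 → ∑ i, ∑ j, c i * c j * K i j ≤ 0

theorem gpsd_iff {n : ℕ} (K : Fin n → Fin n → ℝ) :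
    GPsd K ↔ (Matrix.of K).PosSemidef := by
  rw [Matrix.posSemidef_iff_dotProduct_mulVec]
  unfold GPsd
  refine and_congr ?_ (forall_congr' fun c => ?_)
  · constructor
    · intro h
      ext i j
      simp [Matrix.conjTranspose_apply, h i j]
    · intro h i j
      have := congrFun (congrFun h j) i
      simpa [Matrix.conjTranspose_apply] using this
  · have : star c ⬝ᵥ (Matrix.of K).mulVec c = ∑ i, ∑ j, c i * c j * K i j := by
      simp only [dotProduct, Matrix.mulVec, Finset.mul_sum, Matrix.of_apply, Pi.star_apply,
        star_trivial]
      refine Finset.sum_congr rfl fun i _ => Finset.sum_congr rfl fun j _ => by ring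
    rw [this]

theorem GPsd.mul {n : ℕ} {K L : Fin n → Fin n → ℝ} (hK : GPsd K) (hL : GPsd L) :
    GPsd (fun i j => K i j * L i j) := by
  rw [gpsd_iff] at *
  exact hK.hadamard hL

theorem gpsd_rank_one {n : ℕ} (f : Fin n → ℝ) : GPsd (fun i j => f i * f j) := by
  refine ⟨fun i j => mul_comm _ _, fun c => ?_⟩
  have : ∑ i, ∑ j, c i * c j * (f i * f j) = (∑ i, c i * f i) * (∑ j, c j * f j) := by
    rw [Finset.sum_mul_sum]
    refine Finset.sum_congr rfl fun i _ => Finset.sum_congr rfl fun j _ => by ring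
  rw [this]
  exact mul_self_nonneg _

theorem GPsd.pow {n : ℕ} {K : Fin n → Fin n → ℝ} (hK : GPsd K) (k : ℕ) :
    GPsd (fun i j => K i j ^ k) := by
  induction k with
  | zero => simpa using gpsd_rank_one (fun _ : Fin n => (1 : ℝ))
  | succ k ih => simpa only [pow_succ] using ih.mul hK

theorem GPsd.exp {n : ℕ} {K : Fin n → Fin n → ℝ} (hK : GPsd K) :
    GPsd (fun i j => Real.exp (K i j)) := by
  refine ⟨fun i j => by beta_reduce; rw [hK.1 i j], fun c => ?_⟩
  have h : HasSum (fun k : ℕ => ∑ i, ∑ j, c i * c j * (K i j ^ k / (k.factorial : ℝ)))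
      (∑ i, ∑ j, c i * c j * Real.exp (K i j)) := by
    refine hasSum_sum fun i _ => hasSum_sum fun j _ => HasSum.mul_left _ ?_
    rw [Real.exp_eq_exp_ℝ]
    exact NormedSpace.expSeries_div_hasSum_exp _
  refine h.nonneg fun k => ?_
  have h2 : ∑ i, ∑ j, c i * c j * (K i j ^ k / (k.factorial : ℝ))
      = (∑ i, ∑ j, c i * c j * K i j ^ k) / (k.factorial : ℝ) := by
    simp only [Finset.sum_div]
    refine Finset.sum_congr rfl fun i _ => Finset.sum_congr rfl fun j _ => by ring
  rw [h2]
  exact div_nonneg ((hK.pow k).2 c) (by positivity)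

/-- Schoenberg's theorem. -/
theorem GCnd.exp_neg {n : ℕ} {N : Fin n → Fin n → ℝ} (hN : GCnd N) :
    GPsd (fun i j => Real.exp (-N i j)) := by
  rcases isEmpty_or_nonempty (Fin n) with he | ⟨⟨o⟩⟩
  · exact ⟨fun i => (he.false i).elim, fun c => by simp⟩
  have hA : GPsd (fun i j => N i o + N o j - N i j - N o o) := by
    refine ⟨fun i j => by beta_reduce; rw [hN.1 i o, hN.1 o j, hN.1 i j]; ring, fun c => ?_⟩
    set S := ∑ i, c i with hS
    have h := hN.2 (fun i => c i - if i = o then S else 0) (by simp [Finset.sum_sub_distrib, hS])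
    have e1 : ∑ i, ∑ j, (c i - if i = o then S else 0) * (c j - if j = o then S else 0) * N i j
        = ∑ i, ∑ j, c i * c j * N i j - S * ∑ i, c i * N i o - S * ∑ j, c j * N o j
          + S * S * N o o := by
      simp only [sub_mul, mul_sub, Finset.sum_sub_distrib, ite_mul, mul_ite, zero_mul, mul_zero,
        Finset.sum_ite_eq', Finset.mem_univ, if_true, Finset.mul_sum,
        Finset.sum_ite_irrel, Finset.sum_const_zero]
      have : ∀ i, c i * S * N i o = S * (c i * N i o) := fun i => by ring
      have h' : ∀ i, S * c i * N o i = S * (c i * N o i) := fun i => by ring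
      simp only [this, h']
      ring
    have e2 : ∑ i, ∑ j, c i * c j * (N i o + N o j - N i j - N o o)
        = S * ∑ i, c i * N i o + S * ∑ j, c j * N o j - ∑ i, ∑ j, c i * c j * N i j
          - S * S * N o o := by
      have a1 : S * ∑ i, c i * N i o = ∑ i, ∑ j, c i * c j * N i o := by
        rw [hS, mul_comm, Finset.sum_mul_sum]
        refine Finset.sum_congr rfl fun i _ => Finset.sum_congr rfl fun j _ => by ring
      have a2 : S * ∑ i, c i * N o i = ∑ i, ∑ j, c i * c j * N o j := by
        rw [hS, Finset.sum_mul_sum]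
        refine Finset.sum_congr rfl fun i _ => Finset.sum_congr rfl fun j _ => by ring
      have a3 : S * S * N o o = ∑ i, ∑ j, c i * c j * N o o := by
        rw [hS, Finset.sum_mul_sum, Finset.sum_mul]
        simp only [Finset.sum_mul]
      rw [a1, a2, a3]
      simp only [← Finset.sum_add_distrib, ← Finset.sum_sub_distrib]
      refine Finset.sum_congr rfl fun i _ => Finset.sum_congr rfl fun j _ => by ring
    rw [e1] at h
    rw [e2]
    linarith
  have hB := hA.exp.mul (gpsd_rank_one (fun i => Real.exp (-N i o + N o o / 2)))
  convert hB using 3 with i j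
  rw [← Real.exp_add, ← Real.exp_add, hN.1 o j]
  congr 1
  ring

theorem GCnd.inv_add {n : ℕ} {D : Fin n → Fin n → ℝ} (hD : GCnd D) (h0 : ∀ i j, 0 ≤ D i j)
    {t : ℝ} (ht : 0 < t) : GPsd (fun i j => (t + D i j)⁻¹) := by
  refine ⟨fun i j => by beta_reduce; rw [hD.1 i j], fun c => ?_⟩
  have hneg : ∀ i j, -(t + D i j) < 0 := fun i j => by linarith [h0 i j]
  have hint : ∀ i j, MeasureTheory.IntegrableOn
      (fun s => c i * c j * Real.exp (-(t + D i j) * s)) (Set.Ioi 0) := fun i j =>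
    (integrableOn_exp_mul_Ioi (hneg i j) 0).const_mul _
  have e : ∑ i, ∑ j, c i * c j * (t + D i j)⁻¹
      = ∫ s in Set.Ioi (0 : ℝ), ∑ i, ∑ j, c i * c j * Real.exp (-(t + D i j) * s) := by
    rw [MeasureTheory.integral_finsetSum _ fun i _ =>
      MeasureTheory.integrable_finsetSum _ fun j _ => hint i j]
    refine Finset.sum_congr rfl fun i _ => ?_
    rw [MeasureTheory.integral_finsetSum _ fun j _ => hint i j]
    refine Finset.sum_congr rfl fun j _ => ?_
    rw [MeasureTheory.integral_const_mul, integral_exp_mul_Ioi (hneg i j)]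
    rw [mul_zero, Real.exp_zero, neg_div_neg_eq, one_div]
  rw [e]
  refine MeasureTheory.setIntegral_nonneg measurableSet_Ioi fun s hs => ?_
  have hs : 0 < s := hs
  have hsD : GCnd (fun i j => s * D i j) := by
    refine ⟨fun i j => by beta_reduce; rw [hD.1 i j], fun c hc => ?_⟩
    have := hD.2 c hc
    have e' : ∑ i, ∑ j, c i * c j * (s * D i j) = s * ∑ i, ∑ j, c i * c j * D i j := by
      simp only [Finset.mul_sum]
      refine Finset.sum_congr rfl fun i _ => Finset.sum_congr rfl fun j _ => by ring
    rw [e']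
    exact mul_nonpos_of_nonneg_of_nonpos hs.le this
  have := hsD.exp_neg.2 c
  have e' : ∑ i, ∑ j, c i * c j * Real.exp (-(t + D i j) * s)
      = Real.exp (-(t * s)) * ∑ i, ∑ j, c i * c j * Real.exp (-(s * D i j)) := by
    simp only [Finset.mul_sum]
    refine Finset.sum_congr rfl fun i _ => Finset.sum_congr rfl fun j _ => ?_
    rw [show -(t + D i j) * s = -(t * s) + -(s * D i j) by ring, Real.exp_add]
    ring
  rw [e']
  positivity

theorem GCnd.rpow {n : ℕ} {D : Fin n → Fin n → ℝ} (hD : GCnd D) (h0 : ∀ i j, 0 ≤ D i j)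
    {p : ℝ} (hp : p ∈ Set.Ioo (0 : ℝ) 1) : GCnd (fun i j => D i j ^ p) := by
  refine ⟨fun i j => by beta_reduce; rw [hD.1 i j], fun c hc => ?_⟩
  obtain ⟨μ, hμ⟩ := Real.exists_measure_rpow_eq_integral_rpowIntegrand₀₁ hp
  have hint : ∀ i j, MeasureTheory.IntegrableOn
      (fun t => c i * c j * Real.rpowIntegrand₀₁ p t (D i j)) (Set.Ioi 0) μ := fun i j =>
    (hμ _ (h0 i j)).1.const_mul _
  have e : ∑ i, ∑ j, c i * c j * D i j ^ p
      = ∫ t in Set.Ioi (0 : ℝ), ∑ i, ∑ j, c i * c j * Real.rpowIntegrand₀₁ p t (D i j) ∂μ := by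
    rw [MeasureTheory.integral_finsetSum _ fun i _ =>
      MeasureTheory.integrable_finsetSum _ fun j _ => hint i j]
    refine Finset.sum_congr rfl fun i _ => ?_
    rw [MeasureTheory.integral_finsetSum _ fun j _ => hint i j]
    refine Finset.sum_congr rfl fun j _ => ?_
    rw [MeasureTheory.integral_const_mul, (hμ _ (h0 i j)).2]
  rw [e]
  refine MeasureTheory.setIntegral_nonpos measurableSet_Ioi fun t ht => ?_
  have ht : 0 < t := ht
  have := (hD.inv_add h0 ht).2 c
  have hz : ∑ i, ∑ j, c i * c j = 0 := by rw [← Finset.sum_mul_sum, hc, zero_mul]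
  have e' : ∑ i, ∑ j, c i * c j * Real.rpowIntegrand₀₁ p t (D i j)
      = t ^ p * t⁻¹ * (∑ i, ∑ j, c i * c j)
        - t ^ p * ∑ i, ∑ j, c i * c j * (t + D i j)⁻¹ := by
    simp only [Finset.mul_sum, ← Finset.sum_sub_distrib, Real.rpowIntegrand₀₁]
    refine Finset.sum_congr rfl fun i _ => Finset.sum_congr rfl fun j _ => by ring
  rw [e', hz, mul_zero, zero_sub, neg_nonpos]
  positivity

theorem gcnd_norm_sq {d n : ℕ} (x : Fin n → EuclideanSpace ℝ (Fin d)) :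
    GCnd (fun i j => ‖x i - x j‖ ^ 2) := by
  refine ⟨fun i j => by beta_reduce; rw [norm_sub_rev], fun c hc => ?_⟩
  have e : ∑ i, ∑ j, c i * c j * ‖x i - x j‖ ^ 2
      = (∑ i, c i * ‖x i‖ ^ 2) * (∑ j, c j) + (∑ i, c i) * (∑ j, c j * ‖x j‖ ^ 2)
        - 2 * inner ℝ (∑ i, c i • x i) (∑ j, c j • x j) := by
    rw [Finset.sum_mul_sum, Finset.sum_mul_sum, sum_inner]
    simp only [inner_sum, real_inner_smul_left, real_inner_smul_right]
    simp only [Finset.mul_sum, ← Finset.sum_sub_distrib, ← Finset.sum_add_distrib]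
    refine Finset.sum_congr rfl fun i _ => Finset.sum_congr rfl fun j _ => ?_
    rw [norm_sub_sq_real]
    ring
  rw [e, hc]
  have := real_inner_self_nonneg (x := ∑ i, c i • x i)
  linarith

theorem gcnd_norm_rpow {d n : ℕ} (x : Fin n → EuclideanSpace ℝ (Fin d)) {γ : ℝ}
    (hγ0 : 0 < γ) (hγ2 : γ ≤ 2) : GCnd (fun i j => ‖x i - x j‖ ^ γ) := by
  rcases hγ2.eq_or_lt with rfl | h
  · simpa using gcnd_norm_sq x
  · have := (gcnd_norm_sq x).rpow (fun i j => by positivity) (p := γ / 2)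
      ⟨by linarith, by linarith⟩
    convert this using 3 with i j
    rw [← Real.rpow_natCast, ← Real.rpow_mul (norm_nonneg _)]
    congr 1
    push_cast
    ring

theorem GPsd.complex {n : ℕ} {K : Fin n → Fin n → ℝ} (hK : GPsd K) (c : Fin n → ℂ) :
    (∑ i, ∑ j, c i * (starRingEnd ℂ) (c j) * ((K i j : ℝ) : ℂ)).im = 0 ∧
    0 ≤ (∑ i, ∑ j, c i * (starRingEnd ℂ) (c j) * ((K i j : ℝ) : ℂ)).re := by
  constructor
  · have e : (∑ i, ∑ j, c i * (starRingEnd ℂ) (c j) * ((K i j : ℝ) : ℂ)).im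
        = ∑ i, ∑ j, (c i).im * (c j).re * K i j - ∑ i, ∑ j, (c i).re * (c j).im * K i j := by
      simp only [Complex.im_sum, ← Finset.sum_sub_distrib]
      refine Finset.sum_congr rfl fun i _ => Finset.sum_congr rfl fun j _ => ?_
      simp
      ring
    rw [e, sub_eq_zero, Finset.sum_comm]
    refine Finset.sum_congr rfl fun i _ => Finset.sum_congr rfl fun j _ => ?_
    rw [hK.1 i j]
    ring
  · have e : (∑ i, ∑ j, c i * (starRingEnd ℂ) (c j) * ((K i j : ℝ) : ℂ)).re
        = ∑ i, ∑ j, (c i).re * (c j).re * K i j + ∑ i, ∑ j, (c i).im * (c j).im * K i j := by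
      simp only [Complex.re_sum, ← Finset.sum_add_distrib]
      refine Finset.sum_congr rfl fun i _ => Finset.sum_congr rfl fun j _ => ?_
      simp
      ring
    rw [e]
    exact add_nonneg (hK.2 fun i => (c i).re) (hK.2 fun i => (c i).im)

/-- The γ-exponential kernel `exp(-‖x-y‖^γ)`, `γ ∈ (0,2]`, is positive definite on `ℝ^d`:
every Hermitian quadratic form `Σᵢⱼ cᵢ conj(cⱼ) exp(-‖xᵢ-xⱼ‖^γ)` is a nonnegative real. -/
theorem gammaExponential_positive_definite (d : ℕ) (hd : 1 ≤ d)
    (γ : ℝ) (hγ0 : 0 < γ) (hγ2 : γ ≤ 2)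
    (n : ℕ) (x : Fin n → EuclideanSpace ℝ (Fin d)) (c : Fin n → ℂ) :
    (∑ i, ∑ j, c i * (starRingEnd ℂ) (c j) *
        ((Real.exp (-‖x i - x j‖ ^ γ) : ℝ) : ℂ)).im = 0 ∧
    0 ≤ (∑ i, ∑ j, c i * (starRingEnd ℂ) (c j) *
        ((Real.exp (-‖x i - x j‖ ^ γ) : ℝ) : ℂ)).re := by
  exact (gcnd_norm_rpow x hγ0 hγ2).exp_neg.complex c
end

section
/- Let p > 1 and C > 0. There exists a constant C' > 0 such that for every natural number n ≥ 3 there exists a natural number D ≥ 1 with D · log n + C · n · Σ_{m=D+1}^∞ m^{-p} ≤ C' · n^{1/p} · (log n)^{(p-1)/p}. (This is the optimization underlying the maximum-information-gain bound γ_n = O(n^{d/(β+d)} log^{β/(β+d)} n) for kernels whose Mercer eigenvalues satisfy λ_{m+1} ≤ C m^{-p} with p = (β+d)/d.) -/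
theorem tail_bound_aux (p : ℝ) (hp : 1 < p) (D : ℕ) (hD : 1 ≤ D) :
    (∑' m : ℕ, ((m : ℝ) + D + 1) ^ (-p)) ≤ (D : ℝ) ^ (1 - p) / (p - 1) := by
  have hD0 : (0 : ℝ) < D := by exact_mod_cast hD
  have anti : AntitoneOn (fun x : ℝ => x ^ (-p)) (Set.Ici (D : ℝ)) := by
    intro a ha b hb hab
    exact Real.rpow_le_rpow_of_nonpos (lt_of_lt_of_le hD0 ha) hab (by linarith)
  have h := anti.tsum_comp_add_le_integral D
    (integrableOn_Ioi_rpow_of_lt (by linarith) hD0)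
    (fun x hx => Real.rpow_nonneg (hD0.le.trans (le_of_lt hx)) _)
  rw [integral_Ioi_rpow_of_lt (by linarith) hD0] at h
  have e : -(D : ℝ) ^ (-p + 1) / (-p + 1) = (D : ℝ) ^ (1 - p) / (p - 1) := by
    rw [show -p + 1 = 1 - p by ring, show p - 1 = -(1 - p) by ring, div_neg, neg_div]
  rw [e] at h
  refine le_trans (le_of_eq ?_) h
  refine tsum_congr fun m => ?_
  push_cast
  congr 1
/-- Optimizing the information-gain bound `D log n + C n Σ_{m>D} m^{-p}` over the
truncation level `D` yields `O(n^{1/p} (log n)^{(p-1)/p})` when the eigenvalues decay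
polynomially with exponent `p > 1`. -/
theorem info_gain_polynomial_eigendecay (p C : ℝ) (hp : 1 < p) (hC : 0 < C) :
    ∃ C' : ℝ, 0 < C' ∧
      ∀ n : ℕ, 3 ≤ n →
        ∃ D : ℕ, 1 ≤ D ∧
          (D : ℝ) * Real.log n +
              C * n * (∑' m : ℕ, ((m : ℝ) + D + 1) ^ (-p)) ≤
            C' * (n : ℝ) ^ (1 / p) * Real.log n ^ ((p - 1) / p) := by
  have hp1 : 0 < p - 1 := by linarith
  have hp0 : 0 < p := by linarith
  refine ⟨2 + C / (p - 1), by positivity, fun n hn => ?_⟩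
  have hn3 : (3 : ℝ) ≤ n := by exact_mod_cast hn
  have hn0 : (0 : ℝ) < n := by linarith
  have hL : 0 < Real.log n := Real.log_pos (by linarith)
  have hLn : Real.log n ≤ n := Real.log_le_self hn0.le
  set L := Real.log n
  set x : ℝ := ((n : ℝ) / L) ^ (1 / p) with hx
  have hq : 1 ≤ (n : ℝ) / L := (one_le_div hL).2 hLn
  have hx1 : 1 ≤ x := Real.one_le_rpow hq (by positivity)
  have hx0 : 0 < x := by linarith
  have hD1 : 1 ≤ ⌈x⌉₊ := Nat.one_le_ceil_iff.2 hx0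
  have hxD : x ≤ (⌈x⌉₊ : ℝ) := Nat.le_ceil x
  have hDx : (⌈x⌉₊ : ℝ) ≤ 2 * x := by
    have := Nat.ceil_lt_add_one hx0.le
    linarith
  refine ⟨⌈x⌉₊, hD1, ?_⟩
  have ht := tail_bound_aux p hp ⌈x⌉₊ hD1
  have ht2 : ((⌈x⌉₊ : ℝ)) ^ (1 - p) ≤ x ^ (1 - p) :=
    Real.rpow_le_rpow_of_nonpos hx0 hxD (by linarith)
  have e1 : x * L = (n : ℝ) ^ (1 / p) * L ^ ((p - 1) / p) := by
    rw [hx, Real.div_rpow hn0.le hL.le, show (p - 1) / p = 1 - 1 / p by field_simp,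
      Real.rpow_sub hL, Real.rpow_one]
    ring
  have e2 : (n : ℝ) * x ^ (1 - p) = x * L := by
    have : x ^ p = n / L := by
      rw [hx, ← Real.rpow_mul (by positivity), one_div_mul_cancel hp0.ne', Real.rpow_one]
    rw [Real.rpow_sub hx0, Real.rpow_one, this]
    field_simp
  calc (⌈x⌉₊ : ℝ) * L + C * n * (∑' m : ℕ, ((m : ℝ) + ⌈x⌉₊ + 1) ^ (-p))
      ≤ 2 * x * L + C * n * (x ^ (1 - p) / (p - 1)) := by
        gcongr
        exact ht.trans (by gcongr)
    _ = 2 * (x * L) + C / (p - 1) * (n * x ^ (1 - p)) := by ring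
    _ = (2 + C / (p - 1)) * (n : ℝ) ^ (1 / p) * L ^ ((p - 1) / p) := by
        rw [e2, e1]; ring
end

section
/- Let C₁, C₂ > 0 and let d ≥ 1 be an integer. There exists a constant C' > 0 such that for every natural number n ≥ 3 there exists a natural number D ≥ 1 with D · log n + C₁ · n · Σ_{m=D+1}^∞ exp(-C₂ · m^{1/d}) ≤ C' · (log n)^{d+1}. (This is the optimization underlying the maximum-information-gain bound γ_n = O(log^{d+1} n) for kernels whose Mercer eigenvalues decay as λ_{m+1} ≤ C₁ exp(-C₂ m^{1/d}), such as the square-exponential and rational-quadratic kernels.) -/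
theorem aux_summable (c : ℝ) (hc : 0 < c) (d : ℕ) (hd : 1 ≤ d) :
    Summable (fun m : ℕ => Real.exp (-c * ((m : ℝ) + 1) ^ (1 / (d : ℝ)))) := by
  have h2 : Summable (fun m : ℕ => ((2 * d).factorial / c ^ (2 * d) : ℝ) *
      (1 / (((m + 1 : ℕ) : ℝ)) ^ 2)) := by
    apply Summable.mul_left
    exact (summable_nat_add_iff (f := fun m : ℕ => 1 / (m : ℝ) ^ 2) 1).2
      (Real.summable_one_div_nat_pow.2 (by norm_num))
  refine Summable.of_nonneg_of_le (fun m => (Real.exp_pos _).le) (fun m => ?_) h2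
  have hm : (0 : ℝ) < (m : ℝ) + 1 := by positivity
  set x : ℝ := ((m : ℝ) + 1) ^ (1 / (d : ℝ)) with hx
  have hx0 : 0 < x := Real.rpow_pos_of_pos hm _
  have hxd : x ^ d = (m : ℝ) + 1 := by
    rw [hx, one_div]
    exact Real.rpow_inv_natCast_pow hm.le (by omega)
  have h := Real.pow_div_factorial_le_exp (c * x) (by positivity) (2 * d)
  have e : (c * x) ^ (2 * d) = c ^ (2 * d) * ((m : ℝ) + 1) ^ 2 := by
    rw [mul_pow, ← hxd]; ring
  rw [e] at h
  rw [neg_mul, Real.exp_neg]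
  push_cast
  calc (Real.exp (c * x))⁻¹ ≤ (c ^ (2 * d) * ((m : ℝ) + 1) ^ 2 / (2 * d).factorial)⁻¹ := by
        apply inv_anti₀ _ h
        positivity
    _ = _ := by
        have := Nat.factorial_pos (2 * d)
        field_simp

/-- Optimizing the information-gain bound `D log n + C₁ n Σ_{m>D} exp(-C₂ m^{1/d})` over
the truncation level `D` yields `O((log n)^{d+1})` when the eigenvalues decay
exponentially in `m^{1/d}`. -/
theorem info_gain_exponential_eigendecay (C₁ C₂ : ℝ) (hC₁ : 0 < C₁) (hC₂ : 0 < C₂)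
    (d : ℕ) (hd : 1 ≤ d) :
    ∃ C' : ℝ, 0 < C' ∧
      ∀ n : ℕ, 3 ≤ n →
        ∃ D : ℕ, 1 ≤ D ∧
          (D : ℝ) * Real.log n +
              C₁ * n * (∑' m : ℕ, Real.exp (-C₂ * ((m : ℝ) + D + 1) ^ (1 / (d : ℝ)))) ≤
            C' * Real.log n ^ (d + 1) := by
  have hS := aux_summable (C₂ / 2) (by positivity) d hd
  set S := ∑' m : ℕ, Real.exp (-(C₂ / 2) * ((m : ℝ) + 1) ^ (1 / (d : ℝ))) with hSdef
  have hS0 : 0 ≤ S := tsum_nonneg (fun m => (Real.exp_pos _).le)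
  refine ⟨(2 / C₂) ^ d + 2 + C₁ * S, by positivity, fun n hn => ?_⟩
  have hn0 : (0 : ℝ) < n := by positivity
  have hn3 : (3 : ℝ) ≤ n := by exact_mod_cast hn
  set L := Real.log n with hL
  have hL1 : 1 ≤ L := by
    rw [hL, Real.le_log_iff_exp_le hn0]
    exact (Real.exp_one_lt_d9.le.trans (by norm_num)).trans hn3
  have hD2 : (⌈(2 / C₂ * L) ^ d⌉₊ : ℝ) < (2 / C₂ * L) ^ d + 1 :=
    Nat.ceil_lt_add_one (by positivity)
  have hD1 : (2 / C₂ * L) ^ d ≤ (⌈(2 / C₂ * L) ^ d⌉₊ : ℝ) := Nat.le_ceil _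
  refine ⟨⌈(2 / C₂ * L) ^ d⌉₊ + 1, by omega, ?_⟩
  set D : ℕ := ⌈(2 / C₂ * L) ^ d⌉₊ + 1 with hD
  have hDu : (D : ℝ) ≤ (2 / C₂ * L) ^ d + 2 := by rw [hD]; push_cast; linarith
  have hDl : (2 / C₂ * L) ^ d ≤ (D : ℝ) := by rw [hD]; push_cast; linarith
  have hterm : ∀ m : ℕ, Real.exp (-C₂ * ((m : ℝ) + D + 1) ^ (1 / (d : ℝ))) ≤
      (n : ℝ)⁻¹ * Real.exp (-(C₂ / 2) * ((m : ℝ) + 1) ^ (1 / (d : ℝ))) := by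
    intro m
    have hm : (0 : ℝ) ≤ m := by positivity
    have hDD : (0 : ℝ) ≤ D := by positivity
    have hx1 : ((m : ℝ) + 1) ^ (1 / (d : ℝ)) ≤ ((m : ℝ) + D + 1) ^ (1 / (d : ℝ)) :=
      Real.rpow_le_rpow (by positivity) (by linarith) (by positivity)
    have hx2 : 2 / C₂ * L ≤ ((m : ℝ) + D + 1) ^ (1 / (d : ℝ)) := by
      have h := Real.rpow_le_rpow (z := 1 / (d : ℝ)) (by positivity)
        (hDl.trans (by linarith : (D : ℝ) ≤ (m : ℝ) + D + 1)) (by positivity)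
      rwa [one_div, Real.pow_rpow_inv_natCast (by positivity) (by omega), ← one_div] at h
    have hninv : (n : ℝ)⁻¹ = Real.exp (-L) := by rw [Real.exp_neg, hL, Real.exp_log hn0]
    rw [hninv, ← Real.exp_add, Real.exp_le_exp]
    have h3 := mul_le_mul_of_nonneg_left hx2 (by positivity : 0 ≤ C₂ / 2)
    have h4 := mul_le_mul_of_nonneg_left hx1 (by positivity : 0 ≤ C₂ / 2)
    have h5 : C₂ / 2 * (2 / C₂ * L) = L := by field_simp
    linarith
  have hsum : ∑' m : ℕ, Real.exp (-C₂ * ((m : ℝ) + D + 1) ^ (1 / (d : ℝ))) ≤ (n : ℝ)⁻¹ * S := by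
    rw [hSdef, ← tsum_mul_left]
    exact Summable.tsum_le_tsum hterm
      (Summable.of_nonneg_of_le (fun m => (Real.exp_pos _).le) hterm (hS.mul_left _))
      (hS.mul_left _)
  have hLd : 1 ≤ L ^ d := one_le_pow₀ hL1
  have hLd1 : 1 ≤ L ^ (d + 1) := one_le_pow₀ hL1
  have hA : (D : ℝ) * L ≤ ((2 / C₂) ^ d + 2) * L ^ (d + 1) := by
    have : (D : ℝ) ≤ ((2 / C₂) ^ d + 2) * L ^ d := by
      rw [mul_pow] at hDu
      linarith
    calc (D : ℝ) * L ≤ (((2 / C₂) ^ d + 2) * L ^ d) * L := by gcongr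
      _ = _ := by ring
  have hB : C₁ * n * (∑' m : ℕ, Real.exp (-C₂ * ((m : ℝ) + D + 1) ^ (1 / (d : ℝ))))
      ≤ C₁ * S * L ^ (d + 1) := by
    calc _ ≤ C₁ * n * ((n : ℝ)⁻¹ * S) := by gcongr
      _ = C₁ * S * 1 := by field_simp
      _ ≤ _ := by gcongr
  linarith
end

section
/- Let D ≥ 1 and n be natural numbers, X a type, φ : X → ℝ^D a feature map, and κ ≥ 0 with ‖φ(x)‖² ≤ κ for all x ∈ X. Let x₁, …, xₙ ∈ X, let σ > 0, and let K be the n × n Gram matrix with entries K_{ij} = ⟨φ(x_i), φ(x_j)⟩. Then det(I_n + σ^{-2} K) ≤ (1 + n·κ/(D·σ²))^D. (Hence the information gain (1/2)·log det(I_n + σ^{-2}K) of any n observations under a rank-D kernel with k(x,x) ≤ κ is at most (D/2)·log(1 + nκ/(Dσ²)) = O(D log n).) -/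
open scoped RealInnerProductSpace

/-- AM-GM for the determinant of a positive semidefinite real matrix. -/
theorem det_le_trace_div_pow {D : ℕ} (hD : 1 ≤ D) (A : Matrix (Fin D) (Fin D) ℝ)
    (hA : A.PosSemidef) : A.det ≤ (A.trace / D) ^ D := by
  have hD0 : (0 : ℝ) < D := by exact_mod_cast hD
  have h := Real.geom_mean_le_arith_mean Finset.univ (fun _ : Fin D => (1 : ℝ))
    hA.isHermitian.eigenvalues (by simp) (by simpa using hD0) (fun i _ => hA.eigenvalues_nonneg i)
  have hd : A.det = ∏ i, hA.isHermitian.eigenvalues i := by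
    simpa using hA.isHermitian.det_eq_prod_eigenvalues
  have ht : A.trace = ∑ i, hA.isHermitian.eigenvalues i := by
    simpa using hA.isHermitian.trace_eq_sum_eigenvalues
  simp only [Real.rpow_one, one_mul, Finset.sum_const, Finset.card_univ, Fintype.card_fin,
    nsmul_eq_mul, mul_one] at h
  rw [← hd, ← ht] at h
  have hdet : 0 ≤ A.det := by
    rw [hd]
    exact Finset.prod_nonneg fun i _ => hA.eigenvalues_nonneg i
  have h2 := pow_le_pow_left₀ (Real.rpow_nonneg hdet _) h D
  rwa [Real.rpow_inv_natCast_pow hdet (by omega)] at h2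

/-- Log-determinant information-gain bound for rank-`D` kernels: if `k(x,y) = ⟨φ(x),φ(y)⟩`
with `‖φ(x)‖² ≤ κ`, then the Gram matrix `K` at any `n` points satisfies
`det(I + σ⁻²K) ≤ (1 + nκ/(Dσ²))^D`. -/
theorem det_bound_finite_rank_kernel (D n : ℕ) (hD : 1 ≤ D) (X : Type*)
    (φ : X → EuclideanSpace ℝ (Fin D)) (κ : ℝ) (hκ : 0 ≤ κ)
    (hφ : ∀ x : X, ‖φ x‖ ^ 2 ≤ κ) (x : Fin n → X) (σ : ℝ) (hσ : 0 < σ) :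
    Matrix.det
        (1 + (σ ^ 2)⁻¹ •
          Matrix.of (fun i j : Fin n => (⟪φ (x i), φ (x j)⟫ : ℝ))) ≤
      (1 + (n : ℝ) * κ / ((D : ℝ) * σ ^ 2)) ^ D := by
  have hD0 : (0 : ℝ) < D := by exact_mod_cast hD
  let B : Matrix (Fin n) (Fin D) ℝ := Matrix.of fun i j => σ⁻¹ * φ (x i) j
  have hB : (σ ^ 2)⁻¹ • Matrix.of (fun i j : Fin n => (⟪φ (x i), φ (x j)⟫ : ℝ))
      = B * B.transpose := by
    ext i j
    simp only [Matrix.smul_apply, Matrix.of_apply, Matrix.mul_apply, Matrix.transpose_apply, B,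
      PiLp.inner_apply, smul_eq_mul, Finset.mul_sum]
    refine Finset.sum_congr rfl fun k _ => ?_
    simp only [RCLike.inner_apply, conj_trivial]
    field_simp
  rw [hB, Matrix.det_one_add_mul_comm]
  have hps : (1 + B.transpose * B).PosSemidef := by
    refine Matrix.PosSemidef.one.add ?_
    simpa using Matrix.posSemidef_conjTranspose_mul_self B
  have htr : (B.transpose * B).trace ≤ n * (κ / σ ^ 2) := by
    rw [Matrix.trace_mul_comm, ← hB]
    simp only [Matrix.trace, Matrix.diag_apply, Matrix.smul_apply, Matrix.of_apply, smul_eq_mul,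
      real_inner_self_eq_norm_sq]
    calc _ ≤ ∑ _i : Fin n, κ / σ ^ 2 := by
          refine Finset.sum_le_sum fun i _ => ?_
          rw [div_eq_inv_mul]
          exact mul_le_mul_of_nonneg_left (hφ _) (by positivity)
      _ = _ := by simp
  refine (det_le_trace_div_pow hD _ hps).trans ?_
  refine pow_le_pow_left₀ (div_nonneg hps.trace_nonneg hD0.le) ?_ D
  rw [Matrix.trace_add, Matrix.trace_one, Fintype.card_fin, div_le_iff₀ hD0]
  have : (1 + (n : ℝ) * κ / (D * σ ^ 2)) * D = D + n * (κ / σ ^ 2) := by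
    field_simp
  rw [this]
  linarith
end
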